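/- arXiv:2010.06953 — 4 statements merged into one kernel-verified Lean document; each statement's English description precedes it below -/
import Mathlib

section
/- For all natural numbers n > m ≥ 1, there is no injective monoid homomorphism (embedding) from the hypoplactic monoid of rank n, hypo_n, into the hypoplactic monoid of rank m, hypo_m. -/
open FreeMonoid

/-- The alphabet `A = {1 < 2 < 3 < ...}` of positive integers. -/
abbrev Alph : Type := ℕ+

/-- The finite alphabet `A_n = {1 < ... < n}`. -/
abbrev AlphN (n : ℕ) : Type := {a : ℕ+ // (a : ℕ) ≤ n}

/-- The defining relations of the hypoplactic monoid. -/
def HypoRel (u v : FreeMonoid Alph) : Prop :=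
  (∃ a b c : Alph, a ≤ b ∧ b < c ∧
      u = of a * of c * of b ∧ v = of c * of a * of b) ∨
  (∃ a b c : Alph, a < b ∧ b ≤ c ∧
      u = of b * of a * of c ∧ v = of b * of c * of a) ∨
  (∃ a b c d : Alph, a ≤ b ∧ b < c ∧ c ≤ d ∧
      u = of c * of a * of d * of b ∧ v = of a * of c * of b * of d) ∨
  (∃ a b c d : Alph, a < b ∧ b ≤ c ∧ c < d ∧
      u = of b * of d * of a * of c ∧ v = of d * of b * of c * of a)

/-- The hypoplactic congruence on `A*`: the congruence generated by `HypoRel`. -/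
def hypoCon : Con (FreeMonoid Alph) := conGen HypoRel

/-- The infinite-rank hypoplactic monoid `hypo`. -/
abbrev Hypo : Type := hypoCon.Quotient

/-- The inclusion of `A_n*` into `A*`. -/
def inclN (n : ℕ) : FreeMonoid (AlphN n) →* FreeMonoid Alph :=
  FreeMonoid.map Subtype.val

/-- The hypoplactic congruence restricted to `A_n*`. -/
def hypoConN (n : ℕ) : Con (FreeMonoid (AlphN n)) :=
  hypoCon.comap (inclN n) (fun x y => map_mul (inclN n) x y)

/-- The rank-`n` hypoplactic monoid `hypo_n`. -/
abbrev HypoN (n : ℕ) : Type := (hypoConN n).Quotient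

/-- The letter `1` of `A_2`. -/
def a1 : AlphN 2 := ⟨1, by norm_num⟩

/-- The letter `2` of `A_2`. -/
def a2 : AlphN 2 := ⟨2, by norm_num⟩

/-- The homomorphism `φ_{ij} : A* → hypo_2`, sending `i ↦ [1]`, `j ↦ [2]`,
`a ↦ [21]` for `i < a < j`, and every other letter to the identity. -/
def phi (i j : Alph) : FreeMonoid Alph →* HypoN 2 :=
  FreeMonoid.lift fun a =>
    if a = i then (hypoConN 2).mk' (of a1)
    else if a = j then (hypoConN 2).mk' (of a2)
    else if i < a ∧ a < j then (hypoConN 2).mk' (of a2 * of a1)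
    else 1

/-- A monoid `M` satisfies the identity `u ≈ v` (over the alphabet of variables `X`)
if every homomorphic evaluation of the two words in `M` gives equal values. -/
def MSatisfies (M : Type*) [Monoid M] {X : Type*} (u v : FreeMonoid X) : Prop :=
  ∀ ψ : FreeMonoid X →* M, ψ u = ψ v

/-- An identity `u ≈ v` is balanced if every variable occurs the same number of
times in `u` as in `v`. -/
def IsBalanced {X : Type*} [DecidableEq X] (u v : FreeMonoid X) : Prop :=
  ∀ x : X, u.toList.count x = v.toList.count x

/-- A map from a linearly ordered alphabet to a monoid satisfying the hypoplactic relations. -/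
structure IsHypoplactic {α M : Type*} [LinearOrder α] [Monoid M] (ι : α → M) : Prop where
  acb : ∀ {a b c : α}, a ≤ b → b < c → ι a * ι c * ι b = ι c * ι a * ι b
  bac : ∀ {a b c : α}, a < b → b ≤ c → ι b * ι a * ι c = ι b * ι c * ι a
  cadb : ∀ {a b c d : α}, a ≤ b → b < c → c ≤ d →
    ι c * ι a * ι d * ι b = ι a * ι c * ι b * ι d
  bdac : ∀ {a b c d : α}, a < b → b ≤ c → c < d →
    ι b * ι d * ι a * ι c = ι d * ι b * ι c * ι a

/-- The value of a word in a monoid. -/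
def wordProd {α M : Type*} [Monoid M] (ι : α → M) (l : List α) : M := (l.map ι).prod

section wordProd

variable {α M : Type*} [Monoid M] {ι : α → M}

@[simp] lemma wordProd_nil : wordProd ι [] = 1 := rfl

@[simp] lemma wordProd_cons (a : α) (l : List α) :
    wordProd ι (a :: l) = ι a * wordProd ι l := by simp [wordProd]

@[simp] lemma wordProd_append (l l' : List α) :
    wordProd ι (l ++ l') = wordProd ι l * wordProd ι l' := by simp [wordProd]

end wordProd

/-- A list of columns (strictly decreasing words) forming a quasi-ribbon tableau. -/
def IsRibbon {α : Type*} [LinearOrder α] (G : List (List α)) : Prop :=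
  (∀ C ∈ G, C ≠ [] ∧ C.Pairwise (· > ·)) ∧ G.Pairwise fun C C' => ∀ c ∈ C, ∀ d ∈ C', c ≤ d

/-- The letters of a quasi-ribbon tableau lying above a larger letter in their column. -/
def descents {α : Type*} [LinearOrder α] (G : List (List α)) : Set α :=
  {x | ∃ C ∈ G, x ∈ C ∧ ∃ y ∈ C, x < y}

namespace IsHypoplactic

variable {α M : Type*} [LinearOrder α] [Monoid M] {ι : α → M}

lemma acb_mul (h : IsHypoplactic ι) {a b c : α} (hab : a ≤ b) (hbc : b < c) (z : M) :
    ι a * (ι c * (ι b * z)) = ι c * (ι a * (ι b * z)) := by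
  simpa only [mul_assoc] using congrArg (· * z) (h.acb hab hbc)

lemma bac_mul (h : IsHypoplactic ι) {a b c : α} (hab : a < b) (hbc : b ≤ c) (z : M) :
    ι b * (ι a * (ι c * z)) = ι b * (ι c * (ι a * z)) := by
  simpa only [mul_assoc] using congrArg (· * z) (h.bac hab hbc)

lemma cadb_mul (h : IsHypoplactic ι) {a b c d : α} (hab : a ≤ b) (hbc : b < c) (hcd : c ≤ d)
    (z : M) : ι c * (ι a * (ι d * (ι b * z))) = ι a * (ι c * (ι b * (ι d * z))) := by
  simpa only [mul_assoc] using congrArg (· * z) (h.cadb hab hbc hcd)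

lemma bdac_mul (h : IsHypoplactic ι) {a b c d : α} (hab : a < b) (hbc : b ≤ c) (hcd : c < d)
    (z : M) : ι b * (ι d * (ι a * (ι c * z))) = ι d * (ι b * (ι c * (ι a * z))) := by
  simpa only [mul_assoc] using congrArg (· * z) (h.bdac hab hbc hcd)

/-- A small letter moves left through a column of large letters, next to a letter in between. -/
lemma column_comm_letter (h : IsHypoplactic ι) {x y : α} (hxy : x < y) (D : List α)
    (hD : D.Pairwise (· > ·)) (hy : ∀ d ∈ D, y ≤ d) (z : M) :
    ι y * (wordProd ι D * (ι x * z)) = ι y * (ι x * (wordProd ι D * z)) := by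
  induction D generalizing z with
  | nil => simp
  | cons e D ih =>
    cases D with
    | nil => simp [h.bac_mul hxy (hy e (by simp))]
    | cons f D =>
      have hfe : f < e := by simp at hD; exact hD.1.1
      have hyf : y ≤ f := hy f (by simp)
      have ih := ih hD.of_cons (fun d hd => hy d (by simp [hd])) z
      simp only [wordProd_cons, mul_assoc] at ih ⊢
      rw [h.acb_mul hyf hfe, ih, h.bac_mul hxy hyf, ← h.bdac_mul hxy hyf hfe,
        h.bac_mul hxy (hyf.trans hfe.le)]

/-- The tail of a column commutes with a column of letters that are at least its head. -/
lemma column_comm_tail (h : IsHypoplactic ι) {D : List α} (hD : D.Pairwise (· > ·))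
    (Q : List α) (q : α) (hQ : (q :: Q).Pairwise (· > ·)) (hq : ∀ d ∈ D, q ≤ d) (z : M) :
    ι q * (wordProd ι Q * (wordProd ι D * z)) = ι q * (wordProd ι D * (wordProd ι Q * z)) := by
  induction Q generalizing q with
  | nil => simp
  | cons x Q ih =>
    have hxq : x < q := by simp at hQ; exact hQ.1.1
    have ih := ih x hQ.of_cons (fun d hd => hxq.le.trans (hq d hd))
    simp only [wordProd_cons, mul_assoc] at ih ⊢
    rw [ih, h.column_comm_letter hxq D hD hq]

/-- A large letter moves right through a column of small letters, towards a letter in between. -/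
lemma letter_comm_column (h : IsHypoplactic ι) {p x : α} (hxp : x < p) (Q : List α)
    (hQ : Q.Pairwise (· > ·)) (hx : ∀ q ∈ Q, q ≤ x) (z : M) :
    ι p * (wordProd ι Q * (ι x * z)) = wordProd ι Q * (ι p * (ι x * z)) := by
  induction Q generalizing z with
  | nil => simp
  | cons f Q ih =>
    have hfx : f ≤ x := hx f (by simp)
    cases Q with
    | nil => simp [h.acb_mul hfx hxp]
    | cons g Q =>
      have hgf : g < f := by simp at hQ; exact hQ.1.1
      have ih := ih hQ.of_cons (fun d hd => hx d (by simp [hd])) z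
      have hb := h.column_comm_tail (List.pairwise_singleton _ x) (g :: Q) f hQ (by simpa) z
      have hb' := h.column_comm_tail (List.pairwise_singleton _ x) Q g hQ.of_cons
        (by simpa using hgf.le.trans hfx) z
      simp only [wordProd_cons, wordProd_nil, mul_one, mul_assoc] at ih hb hb' ⊢
      rw [hb, ← h.bdac_mul hgf hfx hxp, ← hb', ih]

lemma column_comm_letter_of_pair (h : IsHypoplactic ι) {p q x : α} (hqx : q ≤ x) (hxp : x < p)
    (D : List α) (hD : D.Pairwise (· > ·)) (hp : ∀ d ∈ D, p ≤ d) (z : M) :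
    ι p * (ι q * (wordProd ι D * (ι x * z))) = ι p * (ι q * (ι x * (wordProd ι D * z))) := by
  induction D generalizing z with
  | nil => simp
  | cons e D ih =>
    have hpe : p ≤ e := hp e (by simp)
    cases D with
    | nil =>
      simp only [wordProd_cons, wordProd_nil, one_mul, mul_assoc]
      rw [h.cadb_mul hqx hxp hpe, h.acb_mul hqx hxp]
    | cons f D =>
      have hfe : f < e := by simp at hD; exact hD.1.1
      have hpf : p ≤ f := hp f (by simp)
      have hqp : q < p := hqx.trans_lt hxp
      have ih := ih hD.of_cons (fun d hd => hp d (by simp [hd])) z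
      simp only [wordProd_cons, mul_assoc] at ih ⊢
      calc _ = ι e * (ι p * (ι q * (ι f * (wordProd ι D * (ι x * z))))) := by
            rw [h.bac_mul hqp hpe, h.bdac_mul hqp hpf hfe, ← h.bac_mul hqp hpf]
        _ = ι e * (ι q * (ι p * (ι x * (ι f * (wordProd ι D * z))))) := by
            rw [ih, h.acb_mul hqx hxp]
        _ = ι q * (ι e * (ι p * (ι f * (ι x * (wordProd ι D * z))))) := by
            rw [← h.acb_mul hqp.le (hpf.trans_lt hfe), h.bac_mul hxp hpf]
        _ = _ := by
            rw [← h.bdac_mul hxp hpf hfe, ← h.bac_mul hxp hpe, h.acb_mul hqx hxp]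

/-- A letter moves left through a column of large letters, next to a column that it splits. -/
lemma column_comm_letter_of_column (h : IsHypoplactic ι) {p x : α} (hxp : x < p)
    (Q : List α) (hQ : Q.Pairwise (· > ·)) (hx : ∀ q ∈ Q, q ≤ x)
    (D : List α) (hD : D.Pairwise (· > ·)) (hp : ∀ d ∈ D, p ≤ d) (z : M) :
    ι p * (wordProd ι Q * (wordProd ι D * (ι x * z))) =
      ι p * (wordProd ι Q * (ι x * (wordProd ι D * z))) := by
  cases Q with
  | nil => simpa using h.column_comm_letter hxp D hD hp z
  | cons q Q =>
    have hqx : q ≤ x := hx q (by simp)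
    have hDx : (D ++ [x]).Pairwise (· > ·) := by
      simp only [List.pairwise_append, hD, List.pairwise_singleton, true_and]
      simpa using fun d hd => hxp.trans_le (hp d hd)
    have hxQ : (x :: Q).Pairwise (· > ·) := by
      simp only [List.pairwise_cons] at hQ ⊢
      exact ⟨fun a ha => (hQ.1 a ha).trans_le hqx, hQ.2⟩
    have e1 := h.column_comm_tail hDx Q q hQ (by
      simp only [List.mem_append, List.mem_singleton]
      rintro d (hd | rfl)
      · exact hqx.trans (hxp.le.trans (hp d hd))
      · exact hqx) z
    have e2 := h.column_comm_tail hD Q x hxQ (fun d hd => hxp.le.trans (hp d hd)) z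
    have e3 := h.column_comm_tail (List.pairwise_singleton _ x) Q q hQ (by simpa)
      (wordProd ι D * z)
    simp only [wordProd_cons, wordProd_append, wordProd_nil, mul_one, mul_assoc] at e1 e2 e3 ⊢
    rw [e1, h.column_comm_letter_of_pair hqx hxp D hD hp, ← e2, e3]

/-- A letter moves left through a quasi-ribbon tableau of large letters, next to a column that
it splits. -/
lemma ribbon_comm_letter (h : IsHypoplactic ι) {p x : α} (hxp : x < p)
    (Q : List α) (hQ : Q.Pairwise (· > ·)) (hx : ∀ q ∈ Q, q ≤ x)
    (G : List (List α)) (hG : IsRibbon G) (hp : ∀ d ∈ G.flatten, p ≤ d) (z : M) :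
    ι p * (wordProd ι Q * (wordProd ι G.flatten * (ι x * z))) =
      ι p * (wordProd ι Q * (ι x * (wordProd ι G.flatten * z))) := by
  induction G generalizing p Q z with
  | nil => simp
  | cons D G ih =>
    obtain ⟨hD0, hD⟩ := hG.1 D (by simp)
    have hpD : ∀ d ∈ D, p ≤ d := fun d hd => hp d (by simp [hd])
    have key := h.column_comm_letter_of_column hxp Q hQ hx D hD hpD (wordProd ι G.flatten * z)
    obtain ⟨D, d, rfl⟩ := List.eq_nil_or_concat D |>.resolve_left hD0
    have hG2 := List.pairwise_cons.1 hG.2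
    have ih := ih (hxp.trans_le (hpD d (by simp))) [] List.Pairwise.nil (by simp)
      ⟨fun C hC => hG.1 C (by simp [hC]), hG2.2⟩
      (fun e he => by
        obtain ⟨C, hC, heC⟩ := List.mem_flatten.1 he
        exact hG2.1 C hC d (by simp) e heC) z
    simp only [List.flatten_cons, List.concat_eq_append, wordProd_cons, wordProd_append,
      wordProd_nil, mul_one, one_mul, mul_assoc] at ih key ⊢
    rw [ih, key]

/-- A column of large letters moves right through a column of small letters, towards a letter
in between. -/
lemma column_comm_column (h : IsHypoplactic ι) {x : α} (Q : List α) (hQ : Q.Pairwise (· > ·))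
    (hx : ∀ q ∈ Q, q ≤ x) (P : List α) (hP : P.Pairwise (· > ·)) (hxP : ∀ p ∈ P, x < p) (z : M) :
    wordProd ι P * (wordProd ι Q * (ι x * z)) = wordProd ι Q * (wordProd ι P * (ι x * z)) := by
  induction P with
  | nil => simp
  | cons p P ih =>
    have ih := ih hP.of_cons fun a ha => hxP a (by simp [ha])
    simp only [wordProd_cons, mul_assoc]
    rw [ih]
    cases P with
    | nil => simpa using h.letter_comm_column (hxP p (by simp)) Q hQ hx z
    | cons r P =>
      have hrp : r < p := by simp at hP; exact hP.1.1
      simp only [wordProd_cons, mul_assoc]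
      exact h.letter_comm_column hrp Q hQ
        (fun q hq => (hx q hq).trans (hxP r (by simp)).le) _

/-- Insertion of a letter in a quasi-ribbon tableau. -/
lemma exists_ribbon_insert (h : IsHypoplactic ι) (x : α) (G : List (List α)) (hG : IsRibbon G) :
    ∃ G', IsRibbon G' ∧ G'.flatten.Perm (x :: G.flatten) ∧
      wordProd ι G.flatten * ι x = wordProd ι G'.flatten := by
  induction G with
  | nil => exact ⟨[[x]], by simp [IsRibbon], by simp, by simp⟩
  | cons C G ih =>
    have hG2 := List.pairwise_cons.1 hG.2
    have hG1 : IsRibbon G := ⟨fun C hC => hG.1 C (by simp [hC]), hG2.2⟩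
    obtain ⟨hC0, hC⟩ := hG.1 C (by simp)
    have hCG : ∀ c ∈ C, ∀ d ∈ G.flatten, c ≤ d := fun c hc d hd => by
      obtain ⟨C', hC', hd⟩ := List.mem_flatten.1 hd
      exact hG2.1 C' hC' c hc d hd
    by_cases hCx : ∀ c ∈ C, c ≤ x
    · obtain ⟨G', hG', hperm, hprod⟩ := ih hG1
      refine ⟨C :: G', ⟨?_, List.pairwise_cons.2 ⟨fun C' hC' c hc d hd => ?_, hG'.2⟩⟩, ?_, ?_⟩
      · simpa using ⟨⟨hC0, hC⟩, hG'.1⟩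
      · have : d ∈ x :: G.flatten := hperm.subset (List.mem_flatten.2 ⟨C', hC', hd⟩)
        rcases List.mem_cons.1 this with rfl | hd
        · exact hCx c hc
        · exact hCG c hc d hd
      · simpa using (hperm.append_left C).trans List.perm_middle
      · simp [mul_assoc, hprod]
    · obtain ⟨P, Q, rfl, hxP, hQx⟩ : ∃ P Q, C = P ++ Q ∧ (∀ p ∈ P, x < p) ∧ ∀ q ∈ Q, q ≤ x := by
        clear hCx hCG hC0 hG2 hG ih
        induction C with
        | nil => exact ⟨[], [], by simp⟩
        | cons c C ih =>
          rcases lt_or_ge x c with hxc | hxc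
          · obtain ⟨P, Q, rfl, h1, h2⟩ := ih hC.of_cons
            exact ⟨c :: P, Q, by simp, by simpa using ⟨hxc, h1⟩, h2⟩
          · refine ⟨[], c :: C, by simp, by simp, ?_⟩
            simpa using ⟨hxc, fun a ha => ((List.pairwise_cons.1 hC).1 a ha).le.trans hxc⟩
      obtain ⟨hP, hQ, -⟩ := List.pairwise_append.1 hC
      have hP0 : P ≠ [] := by
        rintro rfl
        exact hCx (by simpa using hQx)
      have hPx : (P ++ [x]).Pairwise (· > ·) := by
        simp only [List.pairwise_append, hP, List.pairwise_singleton, true_and]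
        simpa using hxP
      have hPG : ∀ p ∈ P ++ [x], ∀ d ∈ G.flatten, p ≤ d := by
        intro p hp d hd
        rcases List.mem_append.1 hp with hp | hp
        · exact hCG p (by simp [hp]) d hd
        · obtain ⟨a, ha⟩ := List.exists_mem_of_ne_nil P hP0
          rw [List.mem_singleton.1 hp]
          exact (hxP a ha).le.trans (hCG a (by simp [ha]) d hd)
      have hprod : wordProd ι ((P ++ Q) :: G).flatten * ι x =
          wordProd ι (Q ++ (P ++ [x]) ++ G.flatten) := by
        have e := h.column_comm_column Q hQ hQx P hP hxP (wordProd ι G.flatten)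
        obtain ⟨P, p, rfl⟩ := List.eq_nil_or_concat P |>.resolve_left hP0
        have e' := h.ribbon_comm_letter (hxP p (by simp)) Q hQ hQx G hG1
          (fun d hd => hCG p (by simp) d hd) 1
        simp only [List.flatten_cons, List.concat_eq_append, wordProd_cons, wordProd_append,
          wordProd_nil, mul_one, mul_assoc] at e e' ⊢
        rw [e', e]
      have hrib : IsRibbon ((P ++ [x]) :: G) := by
        refine ⟨?_, List.pairwise_cons.2 ⟨fun C' hC' c hc d hd =>
          hPG c hc d (List.mem_flatten.2 ⟨C', hC', hd⟩), hG1.2⟩⟩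
        intro C hC
        rcases List.mem_cons.1 hC with rfl | hC
        · exact ⟨by simp, hPx⟩
        · exact hG1.1 C hC
      have hperm : (Q ++ (P ++ [x]) ++ G.flatten).Perm (x :: ((P ++ Q) :: G).flatten) := by
        rw [List.perm_iff_count]
        intro a
        simp only [List.count_append, List.count_cons, List.flatten_cons, List.count_nil]
        omega
      rcases eq_or_ne Q [] with rfl | hQ0
      · exact ⟨(P ++ [x]) :: G, hrib, by simp, by simpa using hprod⟩
      · refine ⟨Q :: (P ++ [x]) :: G, ⟨?_, List.pairwise_cons.2 ⟨?_, hrib.2⟩⟩,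
          by simpa using hperm, by simpa using hprod⟩
        · intro C hC
          rcases List.mem_cons.1 hC with rfl | hC
          · exact ⟨hQ0, hQ⟩
          · exact hrib.1 C hC
        · intro C' hC' q hq d hd
          rcases List.mem_cons.1 hC' with rfl | hC'
          · rcases List.mem_append.1 hd with hd | hd
            · exact (hQx q hq).trans (hxP d hd).le
            · rw [List.mem_singleton.1 hd]
              exact hQx q hq
          · exact hCG q (by simp [hq]) d (List.mem_flatten.2 ⟨C', hC', hd⟩)

/-- Every word has the same value as the column reading of a quasi-ribbon tableau. -/
lemma exists_ribbon (h : IsHypoplactic ι) (w : List α) :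
    ∃ G, IsRibbon G ∧ G.flatten.Perm w ∧ wordProd ι w = wordProd ι G.flatten := by
  induction w using List.reverseRecOn with
  | nil => exact ⟨[], by simp [IsRibbon], by simp, by simp⟩
  | append_singleton w x ih =>
    obtain ⟨G, hG, hperm, hprod⟩ := ih
    obtain ⟨G', hG', hperm', hprod'⟩ := h.exists_ribbon_insert x G hG
    refine ⟨G', hG', hperm'.trans ((hperm.cons x).trans ?_), ?_⟩
    · exact (List.perm_append_singleton x w).symm
    · rw [← hprod', ← hprod]
      simp

end IsHypoplactic

namespace IsRibbon

variable {α : Type*} [LinearOrder α]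

lemma pairwise_flatten_reverse {G : List (List α)} (hG : IsRibbon G) :
    (G.map List.reverse).flatten.Pairwise (· ≤ ·) := by
  rw [List.pairwise_flatten]
  constructor
  · intro C hC
    obtain ⟨C, hCG, rfl⟩ := List.mem_map.1 hC
    rw [List.pairwise_reverse]
    exact (hG.1 C hCG).2.imp le_of_lt
  · rw [List.pairwise_map]
    exact hG.2.imp fun h c hc d hd => h c (by simpa using hc) d (by simpa using hd)

open Classical in
/-- A quasi-ribbon tableau is recovered from its sorted content and its descents. -/
lemma splitBy_eq {G : List (List α)} (hG : IsRibbon G) :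
    (G.map List.reverse).flatten.splitBy (fun x y => decide (x < y ∧ x ∈ descents G)) =
      G.map List.reverse := by
  rw [List.splitBy_eq_iff]
  refine ⟨rfl, ?_, ?_, ?_⟩
  · simp only [List.mem_map, List.reverse_eq_nil_iff, not_exists, not_and]
    exact fun C hC => (hG.1 C hC).1
  · intro C hC
    obtain ⟨C, hCG, rfl⟩ := List.mem_map.1 hC
    refine List.Pairwise.isChain ?_
    rw [List.pairwise_reverse]
    refine (hG.1 C hCG).2.imp_of_mem fun {y x} hy hx hxy => ?_
    simpa using ⟨hxy, C, hCG, hx, y, hy, hxy⟩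
  · rw [List.isChain_map, List.isChain_iff_forall_rel_of_append_cons_cons]
    rintro a b l₁ l₂ rfl
    obtain ⟨ha, hasort⟩ := hG.1 a (by simp)
    obtain ⟨hb, hbsort⟩ := hG.1 b (by simp)
    refine ⟨by simpa, by simpa, ?_⟩
    have hmax : ∀ c ∈ a, c ≤ a.head ha := by
      cases a with
      | nil => simp
      | cons c a => simpa using fun d hd => ((List.pairwise_cons.1 hasort).1 d hd).le
    have hpair := hG.2
    simp only [List.pairwise_append, List.pairwise_cons, List.mem_cons] at hpair
    simp only [List.getLast_reverse, List.head_reverse, decide_eq_false_iff_not, not_and]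
    rintro hlt ⟨C, hC, hxC, z, hzC, hxz⟩
    simp only [List.mem_append, List.mem_cons] at hC
    rcases hC with hC | rfl | rfl | hC
    · exact (hpair.2.2 C hC a (Or.inl rfl) z hzC _ (List.head_mem ha)).not_gt hxz
    · exact (hmax z hzC).not_gt hxz
    · obtain ⟨b, d, rfl⟩ := List.eq_nil_or_concat C |>.resolve_left hb
      simp only [List.concat_eq_append, List.getLast_append_singleton] at hlt
      simp only [List.concat_eq_append, List.pairwise_append, List.mem_singleton,
        forall_eq] at hbsort
      simp only [List.concat_eq_append, List.mem_append, List.mem_singleton] at hxC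
      rcases hxC with hxC | hxC
      · exact (hbsort.2.2 _ hxC).not_gt hlt
      · exact hlt.ne hxC
    · exact (hpair.2.1.2.1 C hC _ (List.getLast_mem hb) _ hxC).not_gt hlt

/-- A quasi-ribbon tableau is determined by its content and its descents. -/
lemma eq_of_perm {G H : List (List α)} (hG : IsRibbon G) (hH : IsRibbon H)
    (hperm : G.flatten.Perm H.flatten) (hdesc : descents G = descents H) : G = H := by
  have perm_rev (G : List (List α)) : (G.map List.reverse).flatten.Perm G.flatten := by
    induction G with
    | nil => simp
    | cons C G ih => simpa using (List.reverse_perm C).append ih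
  have hsort : (G.map List.reverse).flatten = (H.map List.reverse).flatten :=
    (((perm_rev G).trans hperm).trans (perm_rev H).symm).eq_of_pairwise
      (fun _ _ _ _ => le_antisymm) hG.pairwise_flatten_reverse hH.pairwise_flatten_reverse
  apply List.map_injective_iff.2 List.reverse_injective
  rw [← hG.splitBy_eq, ← hH.splitBy_eq, hsort, hdesc]

end IsRibbon

/-- The letters of the hypoplactic monoid of rank `m` satisfy the hypoplactic relations. -/
lemma isHypoplactic_hypoN (m : ℕ) :
    IsHypoplactic fun a : AlphN m => (hypoConN m).mk' (of a) := by
  have key (u v : FreeMonoid (AlphN m)) (h : HypoRel (inclN m u) (inclN m v)) :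
      (hypoConN m).mk' u = (hypoConN m).mk' v :=
    (hypoConN m).eq.2 (ConGen.Rel.of _ _ h)
  constructor
  · intro a b c hab hbc
    simp only [← map_mul]
    exact key _ _ (Or.inl ⟨a, b, c, hab, hbc, rfl, rfl⟩)
  · intro a b c hab hbc
    simp only [← map_mul]
    exact key _ _ (Or.inr (Or.inl ⟨a, b, c, hab, hbc, rfl, rfl⟩))
  · intro a b c d hab hbc hcd
    simp only [← map_mul]
    exact key _ _ (Or.inr (Or.inr (Or.inl ⟨a, b, c, d, hab, hbc, hcd, rfl, rfl⟩)))
  · intro a b c d hab hbc hcd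
    simp only [← map_mul]
    exact key _ _ (Or.inr (Or.inr (Or.inr ⟨a, b, c, d, hab, hbc, hcd, rfl, rfl⟩)))

lemma wordProd_hypoN {m : ℕ} (w : FreeMonoid (AlphN m)) :
    wordProd (fun a : AlphN m => (hypoConN m).mk' (of a)) w.toList = (hypoConN m).mk' w := by
  induction w using FreeMonoid.inductionOn' with
  | one => simp
  | of_mul a w ih => rw [FreeMonoid.toList_of_mul, wordProd_cons, ih, map_mul]

/-- Hypoplactic congruent words have the same content. -/
lemma perm_of_hypoCon {u v : FreeMonoid Alph} (h : hypoCon u v) : u.toList.Perm v.toList := by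
  let content : FreeMonoid Alph →* Multiplicative (Multiset Alph) :=
    FreeMonoid.lift fun a => Multiplicative.ofAdd {a}
  have hcontent (w : FreeMonoid Alph) :
      content w = Multiplicative.ofAdd (w.toList : Multiset Alph) := by
    induction w using FreeMonoid.inductionOn' with
    | one => simp
    | of_mul a w ih =>
      rw [map_mul, ih, FreeMonoid.lift_eval_of, ← ofAdd_add]
      simp
  have hle : hypoCon ≤ Con.ker content := by
    refine Con.conGen_le.2 ?_
    rintro u v (⟨a, b, c, -, -, rfl, rfl⟩ | ⟨a, b, c, -, -, rfl, rfl⟩ |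
      ⟨a, b, c, d, -, -, -, rfl, rfl⟩ | ⟨a, b, c, d, -, -, -, rfl, rfl⟩) <;>
    · simp only [Con.ker_rel, map_mul]
      ac_rfl
  have := (Con.ker_rel content).1 (hle h)
  rw [hcontent, hcontent] at this
  exact Multiset.coe_eq_coe.1 (Multiplicative.ofAdd.injective this)

lemma perm_of_mk_eq {n : ℕ} {u v : FreeMonoid (AlphN n)}
    (h : (hypoConN n).mk' u = (hypoConN n).mk' v) : u.toList.Perm v.toList := by
  have := perm_of_hypoCon ((hypoConN n).eq.1 h)
  exact (List.map_perm_map_iff Subtype.val_injective).1 this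

/-- In the hypoplactic monoid of rank `m`, an element is determined by its content together with
a set of letters. -/
lemma exists_descents (m : ℕ) : ∃ F : FreeMonoid (AlphN m) → Set (AlphN m),
    ∀ u v, u.toList.Perm v.toList → F u = F v → (hypoConN m).mk' u = (hypoConN m).mk' v := by
  choose G hG hperm hprod using (isHypoplactic_hypoN m).exists_ribbon
  refine ⟨fun u => descents (G u.toList), fun u v huv hF => ?_⟩
  rw [← wordProd_hypoN, ← wordProd_hypoN, hprod u.toList, hprod v.toList,
    (hG u.toList).eq_of_perm (hG v.toList) (((hperm _).trans huv).trans (hperm _).symm) hF]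

/-- The letters of `A_n` are numbered by `Fin n`. -/
def alphNEquiv (n : ℕ) : AlphN n ≃ Fin n where
  toFun a := ⟨a.1.natPred, by
    have := a.1.natPred_add_one
    have := a.2
    omega⟩
  invFun i := ⟨i.1.succPNat, by simp⟩
  left_inv a := by simp
  right_inv i := by simp

lemma length_lift_le {α β : Type*} (W : α → FreeMonoid β) (C : ℕ)
    (hC : ∀ a, (W a).toList.length ≤ C) (w : FreeMonoid α) :
    (FreeMonoid.lift W w).toList.length ≤ C * w.toList.length := by
  induction w using FreeMonoid.inductionOn' with
  | one => simp
  | of_mul a w ih =>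
    have := hC a
    simp only [map_mul, FreeMonoid.lift_eval_of, FreeMonoid.toList_mul, List.length_append,
      FreeMonoid.toList_of, List.length_singleton]
    rw [mul_add]
    omega

/-- For all `n > m ≥ 1`, there is no embedding (injective monoid homomorphism)
of `hypo_n` into `hypo_m`. -/
theorem no_embedding_hypoN_hypoM (n m : ℕ) (hm : 1 ≤ m) (hnm : m < n) :
    ¬ ∃ f : HypoN n →* HypoN m, Function.Injective f := by
  rintro ⟨f, hf⟩
  obtain ⟨F, hF⟩ := exists_descents m
  let _ : Fintype (AlphN n) := Fintype.ofEquiv _ (alphNEquiv n).symm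
  let _ : Fintype (AlphN m) := Fintype.ofEquiv _ (alphNEquiv m).symm
  have cardn : Fintype.card (AlphN n) = n := by simp [Fintype.card_congr (alphNEquiv n)]
  have cardm : Fintype.card (AlphN m) = m := by simp [Fintype.card_congr (alphNEquiv m)]
  choose W hW using fun a : AlphN n => (hypoConN m).mk'_surjective (f ((hypoConN n).mk' (of a)))
  have hlift (w : FreeMonoid (AlphN n)) :
      f ((hypoConN n).mk' w) = (hypoConN m).mk' (FreeMonoid.lift W w) := by
    have : f.comp (hypoConN n).mk' = (hypoConN m).mk'.comp (FreeMonoid.lift W) := by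
      refine FreeMonoid.hom_eq fun a => ?_
      rw [MonoidHom.comp_apply, MonoidHom.comp_apply, FreeMonoid.lift_eval_of, hW]
    exact DFunLike.congr_fun this w
  let C : ℕ := ∑ a, (W a).toList.length
  have hC (a : AlphN n) : (W a).toList.length ≤ C :=
    Finset.single_le_sum (f := fun a => (W a).toList.length) (by simp) (Finset.mem_univ a)
  let k : ℕ := (2 * (C * n + 1)) ^ m
  let g (e : AlphN n → Fin (k + 1)) : FreeMonoid (AlphN n) :=
    FreeMonoid.ofList (∑ a, Multiset.replicate (e a) a).toList
  have hcount (e : AlphN n → Fin (k + 1)) (a : AlphN n) :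
      ((g e).toList : Multiset (AlphN n)).count a = e a := by
    rw [FreeMonoid.toList_ofList, Multiset.coe_toList, Multiset.count_sum']
    simp [Multiset.count_replicate]
  have hlen (e : AlphN n → Fin (k + 1)) : (g e).toList.length ≤ n * k := by
    simp only [g, FreeMonoid.toList_ofList, Multiset.length_toList, Multiset.card_sum,
      Multiset.card_replicate]
    refine (Finset.sum_le_card_nsmul _ _ k fun a _ => Nat.lt_succ_iff.1 (e a).2).trans ?_
    simp [cardn]
  have hbound (e : AlphN n → Fin (k + 1)) (b : AlphN m) :
      (FreeMonoid.lift W (g e)).toList.count b < C * n * k + 1 := by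
    refine Nat.lt_succ_iff.2 (List.count_le_length.trans ((length_lift_le W C hC _).trans ?_))
    rw [mul_assoc]
    exact Nat.mul_le_mul_left C (hlen e)
  let Φ (e : AlphN n → Fin (k + 1)) : (AlphN m → Fin (C * n * k + 1)) × Set (AlphN m) :=
    (fun b => ⟨_, hbound e b⟩, F (FreeMonoid.lift W (g e)))
  have hcard : Fintype.card ((AlphN m → Fin (C * n * k + 1)) × Set (AlphN m)) <
      Fintype.card (AlphN n → Fin (k + 1)) := by
    simp only [Fintype.card_prod, Fintype.card_fun, Fintype.card_fin, Fintype.card_set,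
      cardn, cardm]
    calc (C * n * k + 1) ^ m * 2 ^ m
        ≤ ((C * n + 1) * (k + 1)) ^ m * 2 ^ m := by
          gcongr
          nlinarith
      _ = k * (k + 1) ^ m := by
          simp only [k, mul_pow]
          ring
      _ < (k + 1) * (k + 1) ^ m := by gcongr; omega
      _ = (k + 1) ^ (m + 1) := by ring
      _ ≤ (k + 1) ^ n := Nat.pow_le_pow_right (by omega) hnm
  obtain ⟨e, e', hne, heq⟩ := Fintype.exists_ne_map_eq_of_card_lt Φ hcard
  have hperm : (FreeMonoid.lift W (g e)).toList.Perm (FreeMonoid.lift W (g e')).toList :=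
    List.perm_iff_count.2 fun b => congrArg Fin.val (congrFun (congrArg Prod.fst heq) b)
  have hmk := hF _ _ hperm (congrArg Prod.snd heq)
  rw [← hlift, ← hlift] at hmk
  have hperm' := perm_of_mk_eq (hf hmk)
  refine hne (funext fun a => Fin.ext ?_)
  rw [← hcount, ← hcount, Multiset.coe_eq_coe.2 hperm']
end

section
/- For every natural number n ≥ 1, there is no injective monoid homomorphism (embedding) from the infinite-rank hypoplactic monoid hypo into the hypoplactic monoid of rank n, hypo_n. -/
open FreeMonoid

/-- The hypoplactic congruence, on words written as lists. -/
def HypoEquiv (u v : List Alph) : Prop := hypoCon (ofList u) (ofList v)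

namespace HypoEquiv

variable {u v w : List Alph}

theorem symm (h : HypoEquiv u v) : HypoEquiv v u := hypoCon.symm h

theorem trans (h : HypoEquiv u v) (h' : HypoEquiv v w) : HypoEquiv u w := hypoCon.trans h h'

theorem rfl : HypoEquiv u u := hypoCon.refl _

theorem append_append (h : HypoEquiv u v) (p s : List Alph) :
    HypoEquiv (p ++ (u ++ s)) (p ++ (v ++ s)) :=
  hypoCon.mul (hypoCon.refl (ofList p)) (hypoCon.mul h (hypoCon.refl (ofList s)))

end HypoEquiv

/-- The relation `acb = cab` with a word inserted before the last letter. -/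
def LeftSwap (R : List Alph) : Prop := ∀ a b c : Alph, a ≤ b → b < c →
  HypoEquiv (a :: c :: (R ++ [b])) (c :: a :: (R ++ [b]))

/-- The relation `bac = bca` with a word inserted after the first letter. -/
def RightSwap (R : List Alph) : Prop := ∀ a b c : Alph, a < b → b ≤ c →
  HypoEquiv (b :: (R ++ [a, c])) (b :: (R ++ [c, a]))

/-- The relation `cadb = acbd` with a word inserted in the middle. -/
def OuterSwap (R : List Alph) : Prop := ∀ a b c d : Alph, a ≤ b → b < c → c ≤ d →
  HypoEquiv (c :: a :: (R ++ [d, b])) (a :: c :: (R ++ [b, d]))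

/-- The relation `bdac = dbca` with a word inserted in the middle. -/
def InnerSwap (R : List Alph) : Prop := ∀ a b c d : Alph, a < b → b ≤ c → c < d →
  HypoEquiv (b :: d :: (R ++ [a, c])) (d :: b :: (R ++ [c, a]))

theorem leftSwap_nil : LeftSwap [] := fun a b c h₁ h₂ =>
  ConGen.Rel.of _ _ (Or.inl ⟨a, b, c, h₁, h₂, rfl, rfl⟩)

theorem rightSwap_nil : RightSwap [] := fun a b c h₁ h₂ =>
  ConGen.Rel.of _ _ (Or.inr (Or.inl ⟨a, b, c, h₁, h₂, rfl, rfl⟩))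

theorem outerSwap_nil : OuterSwap [] := fun a b c d h₁ h₂ h₃ =>
  ConGen.Rel.of _ _ (Or.inr (Or.inr (Or.inl ⟨a, b, c, d, h₁, h₂, h₃, rfl, rfl⟩)))

theorem innerSwap_nil : InnerSwap [] := fun a b c d h₁ h₂ h₃ =>
  ConGen.Rel.of _ _ (Or.inr (Or.inr (Or.inr ⟨a, b, c, d, h₁, h₂, h₃, rfl, rfl⟩)))

theorem LeftSwap.concat {R : List Alph} (h₁ : LeftSwap R) (h₂ : RightSwap R)
    (h₃ : OuterSwap R) (h₄ : InnerSwap R) (z : Alph) : LeftSwap (R ++ [z]) := by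
  intro a b c hab hbc
  rcases lt_or_ge z a with hza | haz
  · have e₁ := h₄ z a b c hza hab hbc
    have e₂ := (h₂ z a b hza hab).append_append [c] []
    simpa using e₁.trans (by simpa using e₂.symm)
  rcases lt_or_ge z c with hzc | hcz
  · simpa using (h₁ a z c haz hzc).append_append [] [b]
  · have e₁ := (h₂ b c z hbc hcz).append_append [a] []
    have e₂ := h₃ a b c z hab hbc hcz
    simpa using HypoEquiv.trans (by simpa using e₁.symm) e₂.symm

theorem RightSwap.cons {R : List Alph} (h₁ : LeftSwap R) (h₂ : RightSwap R)
    (h₃ : OuterSwap R) (h₄ : InnerSwap R) (z : Alph) : RightSwap (z :: R) := by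
  intro a b c hab hbc
  rcases le_or_gt z a with hza | haz
  · have e₁ := h₃ z a b c hza hab hbc
    have e₂ := (h₁ z a b hza hab).append_append [] [c]
    simpa using (e₁.trans (by simpa using e₂)).symm
  rcases le_or_gt z c with hzc | hcz
  · simpa using (h₂ a z c haz hzc).append_append [b] []
  · have e₁ := h₄ a b c z hab hbc hcz
    have e₂ := (h₁ b c z hbc hcz).append_append [] [a]
    simpa using e₁.trans (by simpa using e₂.symm)

/-- A letter `z` moves left past smaller letters when a suitable letter follows. -/
theorem HypoEquiv.move_left {z d : Alph} (hdz : d < z) (R₁ R₂ : List Alph)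
    (hR₁ : ∀ t ∈ R₁, t ≤ d)
    (h : ∀ S : List Alph, S.length < R₁.length + R₂.length → LeftSwap S) :
    HypoEquiv (R₁ ++ z :: (R₂ ++ [d])) (z :: (R₁ ++ (R₂ ++ [d]))) := by
  induction R₁ with
  | nil => exact HypoEquiv.rfl
  | cons t R₁ ih =>
    have e₁ := (ih (fun s hs => hR₁ s (by simp [hs]))
      (fun S hS => h S (by simp; omega))).append_append [t] []
    have e₂ := h (R₁ ++ R₂) (by simp) t d z (hR₁ t (by simp)) hdz
    exact HypoEquiv.trans (by simpa using e₁) (by simpa using e₂)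

/-- A letter `z` moves right past smaller letters when a suitable letter precedes. -/
theorem HypoEquiv.move_right {z d : Alph} (hdz : d ≤ z) (R₁ R₂ : List Alph)
    (hR₂ : ∀ t ∈ R₂, t < d)
    (h : ∀ S : List Alph, S.length < R₁.length + R₂.length → RightSwap S) :
    HypoEquiv (d :: (R₁ ++ z :: R₂)) (d :: (R₁ ++ (R₂ ++ [z]))) := by
  induction R₂ generalizing R₁ with
  | nil => exact HypoEquiv.rfl
  | cons t R₂ ih =>
    have e₁ := (h R₁ (by simp) t d z (hR₂ t (by simp)) hdz).append_append [] R₂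
    have e₂ := ih (R₁ ++ [t]) (fun s hs => hR₂ s (by simp [hs]))
      (fun S hS => h S (by simp at hS ⊢; omega))
    exact HypoEquiv.trans (by simpa using e₁.symm) (by simpa using e₂)

theorem List.exists_first_split {α : Type*} (P : α → Prop) (l : List α) (h : ∃ z ∈ l, P z) :
    ∃ l₁ z l₂, l = l₁ ++ z :: l₂ ∧ P z ∧ ∀ t ∈ l₁, ¬ P t := by
  induction l with
  | nil => simp at h
  | cons x l ih =>
    by_cases hx : P x
    · exact ⟨[], x, l, by simp [hx]⟩
    · obtain ⟨l₁, z, l₂, rfl, hz, hl⟩ := ih (by simpa [hx] using h)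
      exact ⟨x :: l₁, z, l₂, by simp [hx, hz]; exact hl⟩

theorem List.exists_last_split {α : Type*} (P : α → Prop) (l : List α) (h : ∃ z ∈ l, P z) :
    ∃ l₁ z l₂, l = l₁ ++ z :: l₂ ∧ P z ∧ ∀ t ∈ l₂, ¬ P t := by
  obtain ⟨l₁, z, l₂, hl, hz, ht⟩ := l.reverse.exists_first_split P (by simpa using h)
  exact ⟨l₂.reverse, z, l₁.reverse, by simpa using congrArg List.reverse hl, hz, by simpa using ht⟩

theorem OuterSwap.of_shorter {R : List Alph}
    (h₁ : ∀ S : List Alph, S.length ≤ R.length → LeftSwap S)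
    (h₂ : ∀ S : List Alph, S.length ≤ R.length → RightSwap S)
    (h₃ : ∀ S : List Alph, S.length < R.length → OuterSwap S) : OuterSwap R := by
  intro a b c d hab hbc hcd
  by_cases hmid : ∃ z ∈ R, a ≤ z ∧ z ≤ d
  · obtain ⟨z, hzR, haz, hzd⟩ := hmid
    obtain ⟨S, T, rfl⟩ := List.append_of_mem hzR
    rcases lt_or_ge z c with hzc | hcz
    · have e₁ := (h₁ S (by simp) a z c haz hzc).append_append [] (T ++ [d, b])
      have e₂ := (h₂ (S ++ z :: T) le_rfl b c d hbc hcd).append_append [a] []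
      exact HypoEquiv.trans (by simpa using e₁.symm) (by simpa using e₂.symm)
    · have e₁ := (h₂ T (by simp; omega) b z d (by order) hzd).append_append (c :: a :: S) []
      have e₂ := (h₁ (S ++ z :: T) le_rfl a b c hab hbc).append_append [] [d]
      exact HypoEquiv.trans (by simpa using e₁.symm) (by simpa using e₂.symm)
  by_cases hbig : ∃ z ∈ R, d < z
  · obtain ⟨S, z, T, rfl, hdz, hS⟩ := R.exists_first_split _ hbig
    have e₁ := (HypoEquiv.move_left hdz (c :: a :: S) T
      (by simp at hS ⊢; exact ⟨hcd, by order, hS⟩)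
      (fun U hU => h₁ U (by simp at hU ⊢; omega))).append_append [] [b]
    have e₂ := (h₃ (S ++ T) (by simp) a b c d hab hbc hcd).append_append [z] []
    have e₃ := (h₁ (c :: (S ++ T)) (by simp) a b z hab (by order)).append_append [] [d]
    have e₄ := (HypoEquiv.move_left hdz (c :: S) (T ++ [b])
      (by simp at hS ⊢; exact ⟨hcd, hS⟩)
      (fun U hU => h₁ U (by simp at hU ⊢; omega))).append_append [a] []
    simp only [List.append_assoc, List.cons_append, List.nil_append, List.append_nil]
      at e₁ e₂ e₃ e₄ ⊢
    exact e₁.trans (e₂.trans (e₃.symm.trans e₄.symm))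
  rcases R.eq_nil_or_concat' with rfl | ⟨S, z, rfl⟩
  · exact outerSwap_nil a b c d hab hbc hcd
  · have hza : z < a := by
      by_contra hz
      exact hmid ⟨z, by simp, not_lt.1 hz, not_lt.1 fun h => hbig ⟨z, by simp, h⟩⟩
    have e₁ := (h₂ (a :: S) (by simp) z c d (by order) hcd).append_append [] [b]
    have e₂ := (h₂ (S ++ [d]) (by simp) z a b hza hab).append_append [c] []
    have e₃ := (h₃ S (by simp) a b c d hab hbc hcd).append_append [] [z]
    have e₄ := (h₂ (S ++ [b]) (by simp) z c d (by order) hcd).append_append [a] []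
    have e₅ := (h₂ (c :: S) (by simp) z a b hza hab).append_append [] [d]
    simp only [List.append_assoc, List.cons_append, List.nil_append, List.append_nil]
      at e₁ e₂ e₃ e₄ e₅ ⊢
    exact e₁.trans (e₂.trans (e₃.trans (e₄.symm.trans e₅.symm)))

theorem InnerSwap.of_shorter {R : List Alph}
    (h₁ : ∀ S : List Alph, S.length ≤ R.length → LeftSwap S)
    (h₂ : ∀ S : List Alph, S.length ≤ R.length → RightSwap S)
    (h₄ : ∀ S : List Alph, S.length < R.length → InnerSwap S) : InnerSwap R := by
  intro a b c d hab hbc hcd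
  by_cases hmid : ∃ z ∈ R, a < z ∧ z < d
  · obtain ⟨z, hzR, haz, hzd⟩ := hmid
    obtain ⟨S, T, rfl⟩ := List.append_of_mem hzR
    rcases le_or_gt b z with hbz | hzb
    · have e₁ := (h₁ S (by simp) b z d hbz hzd).append_append [] (T ++ [a, c])
      have e₂ := (h₂ (S ++ z :: T) le_rfl a b c hab hbc).append_append [d] []
      exact HypoEquiv.trans (by simpa using e₁) (by simpa using e₂)
    · have e₁ := (h₂ T (by simp; omega) a z c haz (by order)).append_append (b :: d :: S) []
      have e₂ := (h₁ (S ++ z :: T) le_rfl b c d hbc hcd).append_append [] [a]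
      exact HypoEquiv.trans (by simpa using e₁) (by simpa using e₂)
  by_cases hbig : ∃ z ∈ R, d ≤ z
  · obtain ⟨S, z, T, rfl, hdz, hT⟩ := R.exists_last_split _ hbig
    simp only [not_le] at hT
    have e₁ := (HypoEquiv.move_right hdz S (T ++ [a, c])
      (by simp only [List.mem_append, List.mem_cons, List.not_mem_nil, or_false]
          rintro t (ht | rfl | rfl)
          exacts [hT t ht, by order, hcd])
      (fun U hU => h₂ U (by simp at hU ⊢; omega))).append_append [b] []
    have e₂ := (h₄ (S ++ T) (by simp) a b c d hab hbc hcd).append_append [] [z]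
    have e₃ := (h₂ (S ++ (T ++ [c])) (by simp) a b z hab (by order)).append_append [d] []
    have e₄ := (HypoEquiv.move_right hdz (b :: S) (T ++ [c])
      (by simp only [List.mem_append, List.mem_cons, List.not_mem_nil, or_false]
          rintro t (ht | rfl)
          exacts [hT t ht, hcd])
      (fun U hU => h₂ U (by simp at hU ⊢; omega))).append_append [] [a]
    simp only [List.append_assoc, List.cons_append, List.nil_append, List.append_nil]
      at e₁ e₂ e₃ e₄ ⊢
    exact e₁.trans (e₂.trans (e₃.trans e₄.symm))
  cases R with
  | nil => exact innerSwap_nil a b c d hab hbc hcd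
  | cons z S =>
    have hza : z ≤ a := by
      by_contra hz
      exact hmid ⟨z, by simp, not_le.1 hz, not_le.1 fun h => hbig ⟨z, by simp, h⟩⟩
    have e₁ := (h₁ S (by simp) z a d hza (by order)).append_append [b] [c]
    have e₂ := (h₁ (d :: S) (by simp) z a b hza hab).append_append [] [c]
    have e₃ := (h₄ S (by simp) a b c d hab hbc hcd).append_append [z] []
    have e₄ := (h₁ (b :: S) (by simp) z c d (by order) hcd).append_append [] [a]
    have e₅ := (h₁ (S ++ [c]) (by simp) z a b hza hab).append_append [d] []
    simp only [List.append_assoc, List.cons_append, List.nil_append, List.append_nil]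
      at e₁ e₂ e₃ e₄ e₅ ⊢
    exact e₁.symm.trans (e₂.symm.trans (e₃.trans (e₄.trans e₅)))

theorem swaps_of_length_le (m : ℕ) : ∀ R : List Alph, R.length ≤ m →
    LeftSwap R ∧ RightSwap R ∧ OuterSwap R ∧ InnerSwap R := by
  induction m with
  | zero =>
    intro R hR
    obtain rfl : R = [] := by simpa using hR
    exact ⟨leftSwap_nil, rightSwap_nil, outerSwap_nil, innerSwap_nil⟩
  | succ m ih =>
    have h₁ : ∀ R : List Alph, R.length ≤ m + 1 → LeftSwap R := by
      intro R hR
      rcases R.eq_nil_or_concat' with rfl | ⟨S, z, rfl⟩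
      · exact leftSwap_nil
      · obtain ⟨q₁, q₂, q₃, q₄⟩ := ih S (by simpa using hR)
        exact q₁.concat q₂ q₃ q₄ z
    have h₂ : ∀ R : List Alph, R.length ≤ m + 1 → RightSwap R := by
      intro R hR
      cases R with
      | nil => exact rightSwap_nil
      | cons z S =>
        obtain ⟨q₁, q₂, q₃, q₄⟩ := ih S (by simpa using hR)
        exact RightSwap.cons q₁ q₂ q₃ q₄ z
    intro R hR
    have h₁' := fun (S : List Alph) (hS : S.length ≤ R.length) => h₁ S (hS.trans hR)
    have h₂' := fun (S : List Alph) (hS : S.length ≤ R.length) => h₂ S (hS.trans hR)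
    exact ⟨h₁ R hR, h₂ R hR,
      OuterSwap.of_shorter h₁' h₂' fun S hS => (ih S (by omega)).2.2.1,
      InnerSwap.of_shorter h₁' h₂' fun S hS => (ih S (by omega)).2.2.2⟩

theorem leftSwap (R : List Alph) : LeftSwap R := (swaps_of_length_le _ R le_rfl).1

/-- Two letters commute when they are followed by a word containing both. -/
theorem HypoEquiv.swap {x y : Alph} {r : List Alph} (hx : x ∈ r) (hy : y ∈ r) :
    HypoEquiv (x :: y :: r) (y :: x :: r) := by
  have key : ∀ {x y : Alph}, x < y → x ∈ r → HypoEquiv (x :: y :: r) (y :: x :: r) := by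
    intro x y hxy hx
    obtain ⟨S, T, rfl⟩ := List.append_of_mem hx
    simpa using (leftSwap S x x y le_rfl hxy).append_append [] T
  rcases lt_trichotomy x y with h | rfl | h
  · exact key h hx
  · exact HypoEquiv.rfl
  · exact (key h hy).symm

/-- Words may be permuted freely when followed by a word containing all their letters. -/
theorem HypoEquiv.append_of_perm {u v r : List Alph} (h : u.Perm v) (hu : ∀ x ∈ u, x ∈ r) :
    HypoEquiv (u ++ r) (v ++ r) := by
  induction h with
  | nil => exact HypoEquiv.rfl
  | cons x _ ih =>
    simpa using (ih fun y hy => hu y (by simp [hy])).append_append [x] []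
  | swap x y l =>
    exact HypoEquiv.swap (List.mem_append_right l (hu y (by simp)))
      (List.mem_append_right l (hu x (by simp)))
  | trans h₁ _ ih₁ ih₂ => exact (ih₁ hu).trans (ih₂ fun x hx => hu x (h₁.mem_iff.2 hx))

/-- The congruence whose classes are the singletons of the weakly increasing words and the set
of all other words. -/
def sortedCon : Con (FreeMonoid Alph) where
  r u v := u = v ∨ ¬ u.toList.Pairwise (· ≤ ·) ∧ ¬ v.toList.Pairwise (· ≤ ·)
  iseqv :=
    { refl := fun _ => Or.inl rfl
      symm := by
        rintro u v (h | ⟨h, h'⟩)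
        exacts [Or.inl h.symm, Or.inr ⟨h', h⟩]
      trans := by
        rintro u v w (rfl | h) (rfl | h')
        exacts [Or.inl rfl, Or.inr h', Or.inr h, Or.inr ⟨h.1, h'.2⟩] }
  mul' := by
    rintro u v w x (rfl | h) (rfl | h')
    · exact Or.inl rfl
    all_goals
      right
      simp only [toList_mul, List.pairwise_append]
      tauto

theorem hypoCon_le_sortedCon : hypoCon ≤ sortedCon := by
  refine Con.conGen_le.2 ?_
  rintro _ _ (⟨a, b, c, h₁, h₂, rfl, rfl⟩ | ⟨a, b, c, h₁, h₂, rfl, rfl⟩ |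
    ⟨a, b, c, d, h₁, h₂, h₃, rfl, rfl⟩ | ⟨a, b, c, d, h₁, h₂, h₃, rfl, rfl⟩)
  all_goals
    right
    simp only [toList_mul, toList_of, List.cons_append, List.nil_append, List.pairwise_cons,
      List.mem_cons, List.not_mem_nil, or_false, forall_eq_or_imp, forall_eq]
    constructor <;> rintro ⟨_, _⟩ <;> order

/-- For every `n ≥ 1`, there is no embedding (injective monoid homomorphism)
of the infinite-rank hypoplactic monoid `hypo` into `hypo_n`. -/
theorem no_embedding_hypo_hypoN (n : ℕ) (hn : 1 ≤ n) :
    ¬ ∃ f : Hypo →* HypoN n, Function.Injective f := by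
  rintro ⟨f, hf⟩
  have : Finite (AlphN n) :=
    Finite.of_injective (fun a : AlphN n => (⟨a.1, Nat.lt_succ_of_le a.2⟩ : Fin (n + 1)))
      fun a b h => Subtype.ext (PNat.coe_injective (by simpa using h))
  choose w hw using fun i : Alph => (hypoConN n).mk'_surjective (f (hypoCon.mk' (of i)))
  obtain ⟨i, j, hij, hsupp⟩ : ∃ i j : Alph, i < j ∧
      {x | x ∈ (w i).toList} = {x | x ∈ (w j).toList} := by
    obtain ⟨i, j, hne, h⟩ := Finite.exists_ne_map_eq_of_infinite
      fun i : Alph => {x | x ∈ (w i).toList}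
    rcases hne.lt_or_gt with h' | h'
    exacts [⟨i, j, h', h⟩, ⟨j, i, h', h.symm⟩]
  have himage : (hypoConN n).mk' (w i * w j * w j) = (hypoConN n).mk' (w j * w i * w j) := by
    refine (Con.eq _).2 ?_
    have h := HypoEquiv.append_of_perm (u := (inclN n (w i)).toList ++ (inclN n (w j)).toList)
      (r := (inclN n (w j)).toList) List.perm_append_comm (by
        simp only [inclN, toList_map, List.mem_append, List.mem_map]
        rintro _ (⟨x, hx, rfl⟩ | hx)
        exacts [⟨x, hsupp.subset hx, rfl⟩, hx])
    simpa [hypoConN, HypoEquiv, Con.comap_rel, mul_assoc] using h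
  have hcon : hypoCon (of i * of j * of j) (of j * of i * of j) := by
    refine (Con.eq _).1 (hf ?_)
    change f (hypoCon.mk' _) = f (hypoCon.mk' _)
    simpa only [map_mul, ← hw] using himage
  rcases hypoCon_le_sortedCon hcon with h | ⟨h, -⟩
  · have h' := congrArg toList h
    simp only [toList_mul, toList_of, List.cons_append, List.nil_append, List.cons.injEq] at h'
    exact hij.ne h'.1
  · refine h ?_
    simp [toList_mul, hij.le]
end

section
/- For every n ≥ 2, the monoid homomorphism φ_n from hypo_n to the direct product of the family (hypo_2) indexed by pairs (i, j) with 1 ≤ i < j ≤ n, whose (i, j)-th component sends the class [w] to φ_ij(w), is well defined and injective. Hence hypo_n embeds into a direct product of n(n−1)/2 copies of hypo_2. -/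
open FreeMonoid

/-- Two words over `A` represent the same element of `hypo`. -/
def HypoEq (u v : List Alph) : Prop := hypoCon (ofList u) (ofList v)

namespace HypoEq

theorem refl (u : List Alph) : HypoEq u u := hypoCon.refl _

theorem symm {u v : List Alph} (h : HypoEq u v) : HypoEq v u := hypoCon.symm h

theorem trans {u v w : List Alph} (h : HypoEq u v) (h' : HypoEq v w) : HypoEq u w :=
  hypoCon.trans h h'

instance : Trans HypoEq HypoEq HypoEq := ⟨trans⟩

theorem append {u v u' v' : List Alph} (h : HypoEq u v) (h' : HypoEq u' v') :
    HypoEq (u ++ u') (v ++ v') := hypoCon.mul h h'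

theorem append_left {u v : List Alph} (p : List Alph) (h : HypoEq u v) :
    HypoEq (p ++ u) (p ++ v) := (refl p).append h

theorem append_right {u v : List Alph} (h : HypoEq u v) (s : List Alph) :
    HypoEq (u ++ s) (v ++ s) := h.append (refl s)

theorem cons {u v : List Alph} (x : Alph) (h : HypoEq u v) : HypoEq (x :: u) (x :: v) :=
  h.append_left [x]

theorem of_rel {u v : List Alph} (h : HypoRel (ofList u) (ofList v)) : HypoEq u v :=
  ConGen.Rel.of _ _ h

theorem acb {a b c : Alph} (h₁ : a ≤ b) (h₂ : b < c) (s : List Alph) :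
    HypoEq (a :: c :: b :: s) (c :: a :: b :: s) :=
  (of_rel (u := [a, c, b]) (v := [c, a, b])
    (Or.inl ⟨a, b, c, h₁, h₂, rfl, rfl⟩)).append_right s

theorem bac {a b c : Alph} (h₁ : a < b) (h₂ : b ≤ c) (s : List Alph) :
    HypoEq (b :: a :: c :: s) (b :: c :: a :: s) :=
  (of_rel (u := [b, a, c]) (v := [b, c, a])
    (Or.inr (Or.inl ⟨a, b, c, h₁, h₂, rfl, rfl⟩))).append_right s

theorem cadb {a b c d : Alph} (h₁ : a ≤ b) (h₂ : b < c) (h₃ : c ≤ d) (s : List Alph) :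
    HypoEq (c :: a :: d :: b :: s) (a :: c :: b :: d :: s) :=
  (of_rel (u := [c, a, d, b]) (v := [a, c, b, d])
    (Or.inr (Or.inr (Or.inl ⟨a, b, c, d, h₁, h₂, h₃, rfl, rfl⟩)))).append_right s

theorem bdac {a b c d : Alph} (h₁ : a < b) (h₂ : b ≤ c) (h₃ : c < d) (s : List Alph) :
    HypoEq (b :: d :: a :: c :: s) (d :: b :: c :: a :: s) :=
  (of_rel (u := [b, d, a, c]) (v := [d, b, c, a])
    (Or.inr (Or.inr (Or.inr ⟨a, b, c, d, h₁, h₂, h₃, rfl, rfl⟩)))).append_right s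

end HypoEq

/-- Two words have the same content and the same inversions between letters that are
consecutive in their common support. -/
def SameInv (u v : List Alph) : Prop :=
  u.Perm v ∧ ∀ i j : Alph, i < j → (∀ k ∈ u, ¬(i < k ∧ k < j)) →
    ([j, i].Sublist u ↔ [j, i].Sublist v)

theorem pair_sublist_append {α : Type*} {x y : α} {u v : List α} :
    [x, y].Sublist (u ++ v) ↔
      [x, y].Sublist u ∨ [x, y].Sublist v ∨ x ∈ u ∧ y ∈ v := by
  constructor
  · intro h
    obtain ⟨l₁, l₂, hl, h₁, h₂⟩ := List.sublist_append_iff.1 h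
    match l₁, hl with
    | [], hl => simp at hl; subst hl; exact Or.inr (Or.inl h₂)
    | [z], hl =>
      simp at hl
      obtain ⟨rfl, rfl⟩ := hl
      exact Or.inr (Or.inr ⟨by simpa using h₁, by simpa using h₂⟩)
    | z :: z' :: l, hl =>
      simp at hl
      obtain ⟨rfl, rfl, rfl, rfl⟩ := hl
      exact Or.inl h₁
  · rintro (h | h | ⟨h, h'⟩)
    · exact h.trans (List.sublist_append_left _ _)
    · exact h.trans (List.sublist_append_right _ _)
    · exact (List.singleton_sublist.2 h).append (List.singleton_sublist.2 h')

theorem pair_sublist_cons {α : Type*} {x y z : α} {v : List α} :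
    [x, y].Sublist (z :: v) ↔ [x, y].Sublist v ∨ x = z ∧ y ∈ v := by
  have := pair_sublist_append (x := x) (y := y) (u := [z]) (v := v)
  have h : ¬ [x, y].Sublist [z] := fun h => by simpa using h.length_le
  simpa [h] using this

namespace SameInv

theorem refl (u : List Alph) : SameInv u u := ⟨List.Perm.refl u, fun _ _ _ _ => Iff.rfl⟩

theorem symm {u v : List Alph} (h : SameInv u v) : SameInv v u :=
  ⟨h.1.symm, fun i j hij hk => (h.2 i j hij fun k hku => hk k (h.1.mem_iff.1 hku)).symm⟩

theorem trans {u v w : List Alph} (h : SameInv u v) (h' : SameInv v w) : SameInv u w :=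
  ⟨h.1.trans h'.1, fun i j hij hk => (h.2 i j hij hk).trans
    (h'.2 i j hij fun k hkv => hk k (h.1.mem_iff.2 hkv))⟩

theorem append {u v u' v' : List Alph} (h : SameInv u v) (h' : SameInv u' v') :
    SameInv (u ++ u') (v ++ v') := by
  refine ⟨h.1.append h'.1, fun i j hij hk => ?_⟩
  rw [pair_sublist_append, pair_sublist_append, h.1.mem_iff, h'.1.mem_iff,
    h.2 i j hij fun k hku => hk k (List.mem_append_left _ hku),
    h'.2 i j hij fun k hku => hk k (List.mem_append_right _ hku)]

theorem swap {p q : List Alph} {a c : Alph} (hac : a < c)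
    (h : (∃ b ∈ p, a < b ∧ b ≤ c) ∨ ∃ b ∈ q, a ≤ b ∧ b < c) :
    SameInv (p ++ a :: c :: q) (p ++ c :: a :: q) := by
  refine ⟨(List.Perm.swap c a q).append_left p, fun i j hij hk => ?_⟩
  simp only [pair_sublist_append, pair_sublist_cons, List.mem_cons, List.mem_append] at hk ⊢
  have key : j = c → i = a → (j ∈ p ∨ i ∈ q) := by
    rintro rfl rfl
    rcases h with ⟨b, hb, h₁, h₂⟩ | ⟨b, hb, h₁, h₂⟩
    · rcases h₂.eq_or_lt with rfl | h₂
      · exact Or.inl hb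
      · exact absurd ⟨h₁, h₂⟩ (hk b (Or.inl hb))
    · rcases h₁.eq_or_lt with rfl | h₁
      · exact Or.inr hb
      · exact absurd ⟨h₁, h₂⟩ (hk b (by tauto))
  have key' : ¬ (j = a ∧ i = c) := by
    rintro ⟨rfl, rfl⟩
    exact absurd hij hac.not_gt
  clear h hk hij hac
  grind

theorem move {p q : List Alph} {a b : Alph} (hab : a < b) (hb : b ∈ p) (hq : ∀ y ∈ q, b ≤ y) :
    SameInv (p ++ a :: q) (p ++ (q ++ [a])) := by
  induction q generalizing p with
  | nil => exact refl _
  | cons y q ih =>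
    have hy := hq y (by simp)
    have h₁ := swap (p := p) (q := q) (hab.trans_le hy) (Or.inl ⟨b, hb, hab, hy⟩)
    have h₂ := ih (p := p ++ [y]) (by simp [hb]) fun z hz => hq z (by simp [hz])
    simp only [List.append_assoc, List.cons_append, List.nil_append] at h₂ ⊢
    exact h₁.trans h₂

end SameInv

/-- Words shorter than `N` are hypoplactically equal as soon as their invariants agree. -/
def CompleteBelow (N : ℕ) : Prop :=
  ∀ u v : List Alph, u.length < N → SameInv u v → HypoEq u v

namespace CompleteBelow

theorem swap_of_mem_left {N : ℕ} (K : CompleteBelow N) {p : List Alph}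
    (q : List Alph) {a b c : Alph} (hab : a < b) (hbc : b ≤ c)
    (hb : b ∈ p) (hN : p.length + q.length + 2 < N) :
    HypoEq (p ++ a :: c :: q) (p ++ c :: a :: q) :=
  K _ _ (by simp; omega) (SameInv.swap (hab.trans_le hbc) (Or.inl ⟨b, hb, hab, hbc⟩))

theorem swap_of_mem_right {N : ℕ} (K : CompleteBelow N)
    {q : List Alph} {a b c : Alph} (hab : a ≤ b) (hbc : b < c)
    (hb : b ∈ q) (hN : q.length + 2 < N) :
    HypoEq (a :: c :: q) (c :: a :: q) :=
  K _ _ (by simpa using hN)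
    (SameInv.swap (p := []) (hab.trans_lt hbc) (Or.inr ⟨b, hb, hab, hbc⟩))

theorem move {N : ℕ} (K : CompleteBelow N)
    {p q : List Alph} {a b : Alph} (hab : a < b) (hb : b ∈ p) (hq : ∀ y ∈ q, b ≤ y)
    (hN : p.length + q.length + 1 < N) : HypoEq (p ++ a :: q) (p ++ (q ++ [a])) :=
  K _ _ (by simp; omega) (SameInv.move hab hb hq)

theorem swap_right {N : ℕ} (K : CompleteBelow N)
    {u : List Alph} {a b c : Alph} (hab : a ≤ b) (hbc : b < c)
    (hu : ∀ y ∈ u, a ≤ y) (hN : u.length + 3 ≤ N) :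
    HypoEq (c :: a :: (u ++ [b])) (a :: c :: (u ++ [b])) := by
  by_cases h : ∃ y ∈ u, y < c
  · obtain ⟨y, hy, hyc⟩ := h
    exact (K.swap_of_mem_right (hu y hy) hyc hy (by omega)).symm.append_right [b]
  push Not at h
  match u, h with
  | [], _ => exact (HypoEq.acb hab hbc []).symm
  | x :: z, h =>
    have hcx : c ≤ x := h x (by simp)
    simp only [List.length_cons] at hN
    by_cases hz : ∃ y ∈ z, y < x
    · obtain ⟨y, hy, hyx⟩ := hz
      have hcy : c ≤ y := h y (by simp [hy])
      calc HypoEq (c :: a :: x :: (z ++ [b])) (c :: x :: a :: (z ++ [b])) :=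
            HypoEq.bac (hab.trans_lt hbc) hcx _
        HypoEq _ (x :: c :: a :: (z ++ [b])) :=
            (K.swap_of_mem_right (q := a :: z) hcy hyx (by simp [hy])
              (by simp; omega)).append_right [b]
        HypoEq _ (x :: a :: c :: (z ++ [b])) :=
            ((K.swap_of_mem_right (q := z ++ [b]) hab hbc (by simp) (by simp; omega)).symm).cons x
        HypoEq _ (a :: x :: c :: (z ++ [b])) :=
            (HypoEq.acb (hab.trans hbc.le) (hcy.trans_lt hyx) _).symm
        HypoEq _ (a :: c :: x :: (z ++ [b])) :=
            ((K.swap_of_mem_right hcy hyx hy (by omega)).symm.append_right [b]).cons a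
    · push Not at hz
      have hm : HypoEq (x :: b :: z) (x :: (z ++ [b])) :=
        K.move (p := [x]) (hbc.trans_le hcx) (by simp) hz (by simp; omega)
      calc HypoEq (c :: a :: x :: (z ++ [b])) (c :: a :: x :: b :: z) :=
            (hm.symm.cons a).cons c
        HypoEq _ (a :: c :: b :: x :: z) := HypoEq.cadb hab hbc hcx z
        HypoEq _ (a :: c :: x :: b :: z) := (HypoEq.bac hbc hcx z).cons a
        HypoEq _ (a :: c :: x :: (z ++ [b])) := (hm.cons c).cons a

theorem swap_left_of_head {N : ℕ} (K : CompleteBelow N)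
    {u : List Alph} {a b c : Alph} (hab : a < b) (hbc : b ≤ c)
    (hu : ∀ y ∈ u, a ≤ y) (hN : u.length + 4 ≤ N) :
    HypoEq (b :: a :: (u ++ [a, c])) (b :: a :: (u ++ [c, a])) := by
  calc HypoEq (b :: a :: (u ++ [a, c])) (a :: b :: (u ++ [a, c])) := by
        simpa using (K.swap_of_mem_right (q := u ++ [a]) le_rfl hab (by simp)
          (by simp; omega)).symm.append_right [c]
    HypoEq _ (a :: b :: (u ++ [c, a])) :=
        (K.swap_of_mem_left (p := b :: u) [] hab hbc (by simp) (by simp; omega)).cons a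
    HypoEq _ (b :: a :: (u ++ [c, a])) := by
        have hu' : ∀ y ∈ u ++ [c], a ≤ y := by
          intro y hy
          rcases List.mem_append.1 hy with hy | hy
          · exact hu y hy
          · rw [List.mem_singleton.1 hy]; exact hab.le.trans hbc
        simpa using (K.swap_right (u := u ++ [c]) le_rfl hab hu' (by simp; omega)).symm

theorem swap_left {N : ℕ} (K : CompleteBelow N)
    {u : List Alph} {a b c : Alph} (hab : a < b) (hbc : b ≤ c)
    (hu : ∀ y ∈ u, a ≤ y) (hN : u.length + 3 ≤ N) :
    HypoEq (b :: (u ++ [a, c])) (b :: (u ++ [c, a])) := by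
  by_cases h : ∃ y ∈ u, a < y ∧ y ≤ c
  · obtain ⟨y, hy, hay, hyc⟩ := h
    exact (K.swap_of_mem_left [] hay hyc hy (by simp; omega)).cons b
  push Not at h
  match u, h with
  | [], _ => exact HypoEq.bac hab hbc []
  | x :: z, h =>
    simp only [List.length_cons] at hN
    have hz : ∀ y ∈ z, a ≤ y := fun y hy => hu y (by simp [hy])
    rcases (hu x (by simp)).eq_or_lt with rfl | hax
    · exact K.swap_left_of_head hab hbc hz (by omega)
    have hcx : c < x := h x (by simp) hax
    by_cases haz : a ∈ z
    · obtain ⟨p, q, rfl, hp⟩ := List.eq_append_cons_of_mem haz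
      have hm : HypoEq (b :: a :: x :: p) (b :: x :: (p ++ [a])) := by
        refine K.move (p := [b]) (q := x :: p) hab (by simp) (fun y hy => ?_)
          (by simp at hN ⊢; omega)
        have hya : a ≠ y := by
          rintro rfl
          rcases List.mem_cons.1 hy with rfl | hy
          · exact hax.false
          · exact hp hy
        have hy' : y ∈ x :: (p ++ a :: q) := by
          rcases List.mem_cons.1 hy with rfl | hy <;> simp [*]
        exact hbc.trans (h y hy' ((hu y hy').lt_of_ne hya)).le
      have ht := K.swap_left_of_head (u := x :: (p ++ q)) hab hbc
        (fun y hy => hu y (by simp at hy ⊢; tauto)) (by simp at hN ⊢; omega)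
      have h₁ := hm.append_right (q ++ [a, c])
      have h₂ := hm.append_right (q ++ [c, a])
      simp only [List.append_assoc, List.cons_append, List.nil_append] at ht h₁ h₂ ⊢
      exact h₁.symm.trans (ht.trans h₂)
    have hcz : ∀ y ∈ z, c < y := fun y hy => h y (by simp [hy])
      ((hz y hy).lt_of_ne (by rintro rfl; exact haz hy))
    by_cases hzx : ∃ y ∈ z, y < x
    · obtain ⟨y, hy, hyx⟩ := hzx
      have hs : HypoEq (b :: x :: z) (x :: b :: z) :=
        K.swap_of_mem_right (hbc.trans (hcz y hy).le) hyx hy (by omega)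
      calc HypoEq (b :: x :: (z ++ [a, c])) (x :: b :: (z ++ [a, c])) := hs.append_right _
        HypoEq _ (x :: b :: (z ++ [c, a])) :=
            (K.swap_of_mem_left (p := b :: z) [] hab hbc (by simp) (by simp; omega)).cons x
        HypoEq _ (b :: x :: (z ++ [c, a])) := hs.symm.append_right _
    push Not at hzx
    calc HypoEq (b :: x :: (z ++ [a, c])) (b :: a :: x :: (z ++ [c])) := by
          simpa using (K.move (p := [b]) (q := x :: z) hab (by simp)
            (fun y hy => by
              rcases List.mem_cons.1 hy with rfl | hy
              · exact hbc.trans hcx.le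
              · exact hbc.trans (hcz y hy).le) (by simp; omega)).symm.append_right [c]
      HypoEq _ (b :: a :: x :: c :: z) :=
          (((K.move (p := [x]) hcx (by simp) hzx (by simp; omega)).symm).cons a).cons b
      HypoEq _ (b :: x :: a :: c :: z) := HypoEq.bac hab (hbc.trans hcx.le) _
      HypoEq _ (x :: b :: c :: a :: z) := HypoEq.bdac hab hbc hcx z
      HypoEq _ (x :: b :: c :: (z ++ [a])) :=
          (K.move (p := [b, c]) hab (by simp) (fun y hy => hbc.trans (hcz y hy).le)
            (by simp; omega)).cons x
      HypoEq _ (x :: b :: (z ++ [c, a])) := by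
          simpa using (K.move (p := [x, b]) hcx (by simp) hzx (by simp; omega)).append_right [a]
      HypoEq _ (b :: x :: (z ++ [c, a])) := by
          simpa using (K.swap_of_mem_right (q := z ++ [c]) hbc hcx (by simp)
            (by simp; omega)).symm.append_right [a]

end CompleteBelow

theorem length_filter_ne_add_count (r : List Alph) (a : Alph) :
    (r.filter (· ≠ a)).length + r.count a = r.length := by
  have := List.length_eq_length_filter_add (l := r) (· ≠ a)
  simp only [ne_eq, decide_not, Bool.not_not, List.count_eq_length_filter] at this ⊢
  rw [this]; rfl

namespace CompleteBelow

theorem swap_min_left {N : ℕ} (K : CompleteBelow N) {p : List Alph} (q : List Alph)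
    {a b c : Alph} (hab : a < b) (hbc : b ≤ c) (hb : b ∈ p) (hp : ∀ y ∈ p, a ≤ y)
    (hN : p.length + q.length + 2 ≤ N) : HypoEq (p ++ a :: c :: q) (p ++ c :: a :: q) := by
  obtain ⟨s, t, rfl⟩ := List.append_of_mem hb
  have := ((K.swap_left (u := t) hab hbc (fun y hy => hp y (by simp [hy]))
    (by simp at hN; omega)).append_left s).append_right q
  simpa using this

theorem swap_min_right {N : ℕ} (K : CompleteBelow N) (p : List Alph) {q : List Alph}
    {a b c : Alph} (hab : a ≤ b) (hbc : b < c) (hb : b ∈ q) (hq : ∀ y ∈ q, a ≤ y)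
    (hN : p.length + q.length + 2 ≤ N) : HypoEq (p ++ a :: c :: q) (p ++ c :: a :: q) := by
  obtain ⟨s, t, rfl⟩ := List.append_of_mem hb
  have := ((K.swap_right (u := s) hab hbc (fun y hy => hq y (by simp [hy]))
    (by simp at hN; omega)).append_left p).append_right t
  simpa using this.symm

/-- The minimal letter `a` moves to the right across `q` when a letter
`b > a` bounding `q` from below stands on its left. -/
theorem move_min_of_mem_left {N : ℕ} (K : CompleteBelow N) {p q : List Alph} {a b : Alph}
    (hab : a < b) (hb : b ∈ p) (hp : ∀ y ∈ p, a ≤ y) (hq : ∀ y ∈ q, b ≤ y)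
    (hN : p.length + q.length + 1 ≤ N) : HypoEq (p ++ a :: q) (p ++ (q ++ [a])) := by
  induction q generalizing p with
  | nil => exact HypoEq.refl _
  | cons y q ih =>
    have hy := hq y (by simp)
    have h₁ := K.swap_min_left q hab hy hb hp (by simp at hN; omega)
    have h₂ := ih (p := p ++ [y]) (by simp [hb])
      (by
        intro z hz
        rcases List.mem_append.1 hz with hz | hz
        · exact hp z hz
        · rw [List.mem_singleton.1 hz]; exact hab.le.trans hy)
      (fun z hz => hq z (by simp [hz])) (by simp at hN ⊢; omega)
    simp only [List.append_assoc, List.cons_append, List.nil_append] at h₂ ⊢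
    exact h₁.trans h₂

/-- The minimal letter `a` moves to the right across `q` when another `a` follows. -/
theorem move_min_of_mem_right {N : ℕ} (K : CompleteBelow N) (p : List Alph) {q s : List Alph}
    {a : Alph} (hs : a ∈ s) (hs' : ∀ y ∈ s, a ≤ y) (hq : ∀ y ∈ q, a < y)
    (hN : p.length + q.length + s.length + 1 ≤ N) :
    HypoEq (p ++ a :: (q ++ s)) (p ++ (q ++ a :: s)) := by
  induction q generalizing p with
  | nil => exact HypoEq.refl _
  | cons y q ih =>
    have h₁ := K.swap_min_right p (q := q ++ s) le_rfl (hq y (by simp)) (by simp [hs])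
      (by
        intro z hz
        rcases List.mem_append.1 hz with hz | hz
        · exact (hq z (by simp [hz])).le
        · exact hs' z hz) (by simp at hN ⊢; omega)
    have h₂ := ih (p ++ [y]) (fun z hz => hq z (by simp [hz])) (by simp at hN ⊢; omega)
    simp only [List.append_assoc, List.cons_append, List.nil_append] at h₂ ⊢
    exact h₁.trans h₂

theorem gather_min_right {N : ℕ} (K : CompleteBelow N) {r : List Alph} {a : Alph}
    (hr : ∀ y ∈ r, a ≤ y) (hN : r.length + 1 ≤ N) :
    HypoEq (r ++ [a]) (r.filter (· ≠ a) ++ List.replicate (r.count a + 1) a) := by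
  induction r with
  | nil => exact HypoEq.refl _
  | cons y r ih =>
    have h := (ih (fun z hz => hr z (by simp [hz])) (by simp at hN; omega)).cons y
    rcases eq_or_ne y a with rfl | hya
    · have hl := length_filter_ne_add_count r y
      have h' := K.move_min_of_mem_right [] (q := r.filter (· ≠ y))
        (s := List.replicate (r.count y + 1) y) (a := y) (by simp)
        (fun z hz => (List.eq_of_mem_replicate hz).ge)
        (fun z hz => by
          simp at hz
          exact (hr z (by simp [hz.1])).lt_of_ne (Ne.symm hz.2))
        (by simp only [List.length_nil, List.length_replicate, List.length_cons] at hN ⊢; omega)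
      refine (h.trans h').trans ?_
      simpa [List.replicate_succ] using HypoEq.refl _
    · simpa [hya] using h

/-- When `b` is the second smallest letter and some `b` precedes some `a`, all the minimal
letters `a` can be gathered at the end. -/
theorem gather_min_of_inversion {N : ℕ} (K : CompleteBelow N) {w : List Alph} {a b : Alph}
    (hw : ∀ y ∈ w, y = a ∨ b ≤ y) (hab : a < b) (hinv : [b, a].Sublist w)
    (hN : w.length ≤ N) :
    HypoEq w (w.filter (· ≠ a) ++ List.replicate (w.count a) a) := by
  have haw : a ∈ w := hinv.subset (by simp)
  obtain ⟨q', p', hrev, hq'⟩ := List.eq_append_cons_of_mem (List.mem_reverse.2 haw)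
  obtain ⟨p, q, rfl, hq⟩ : ∃ p q, w = p ++ a :: q ∧ a ∉ q :=
    ⟨p'.reverse, q'.reverse, by simpa using congrArg List.reverse hrev, by simpa using hq'⟩
  have hge : ∀ y ∈ p ++ a :: q, a ≤ y := fun y hy =>
    (hw y hy).elim (fun h => h.ge) fun h => hab.le.trans h
  have hbp : b ∈ p := by
    simp only [pair_sublist_append, pair_sublist_cons, List.mem_cons] at hinv
    rcases hinv with h | (h | h) | h
    · exact h.subset (by simp)
    · exact absurd (h.subset (by simp)) hq
    · exact absurd h.2 hq
    · exact h.1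
  have h₁ := K.move_min_of_mem_left (q := q) hab hbp (fun y hy => hge y (by simp [hy]))
    (fun y hy => (hw y (by simp [hy])).resolve_left (by rintro rfl; exact hq hy))
    (by simp at hN; omega)
  have h₂ := K.gather_min_right (r := p ++ q) (a := a)
    (fun y hy => hge y (by simp at hy ⊢; tauto)) (by simp at hN ⊢; omega)
  simp only [List.append_assoc] at h₂
  refine (h₁.trans h₂).trans ?_
  simpa [List.count_append, add_assoc] using HypoEq.refl _

/-- When a `b > a` stands to the right, a larger letter `y` moves across a block of `a`s. -/
theorem move_across_replicate {N : ℕ} (K : CompleteBelow N) (k : ℕ) {q : List Alph} {a b y : Alph}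
    (hab : a < b) (hby : b < y) (hb : b ∈ q) (hq : ∀ z ∈ q, a ≤ z) (hN : k + q.length + 1 ≤ N) :
    HypoEq (y :: (List.replicate k a ++ q)) (List.replicate k a ++ y :: q) := by
  induction k with
  | zero => exact HypoEq.refl _
  | succ k ih =>
    have h₁ := K.swap_min_right [] (q := List.replicate k a ++ q) hab.le hby (by simp [hb])
      (by
        intro z hz
        rcases List.mem_append.1 hz with hz | hz
        · exact (List.eq_of_mem_replicate hz).ge
        · exact hq z hz) (by simp; omega)
    have h₂ := (ih (by omega)).cons a
    simp only [List.replicate_succ, List.cons_append]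
    exact h₁.symm.trans h₂

theorem gather_min_left {N : ℕ} (K : CompleteBelow N) {r q : List Alph} {a b : Alph}
    (hr : ∀ y ∈ r, y = a ∨ b < y) (hab : a < b) (hq : ∀ z ∈ q, a ≤ z)
    (hN : r.length + q.length + 1 ≤ N) :
    HypoEq (r ++ b :: q) (List.replicate (r.count a) a ++ (r.filter (· ≠ a) ++ b :: q)) := by
  induction r with
  | nil => exact HypoEq.refl _
  | cons y r ih =>
    have h := (ih (fun z hz => hr z (by simp [hz])) (by simp at hN; omega)).cons y
    rcases hr y (by simp) with rfl | hby
    · simpa [List.replicate_succ] using h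
    · have hl := length_filter_ne_add_count r a
      have h' := K.move_across_replicate (r.count a) (q := r.filter (· ≠ a) ++ b :: q) hab hby
        (by simp)
        (by
          intro z hz
          simp only [List.mem_append, List.mem_cons, List.mem_filter] at hz
          rcases hz with ⟨hz, -⟩ | rfl | hz
          · rcases hr z (by simp [hz]) with rfl | hz
            · exact le_rfl
            · exact (hab.trans hz).le
          · exact hab.le
          · exact hq z hz)
        (by simp only [List.length_append, List.length_cons] at hN ⊢; omega)
      simpa [(hab.trans hby).ne'] using h.trans h'

/-- When `b` is the second smallest letter and no `b` precedes any `a`, all the minimal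
letters `a` can be gathered at the beginning. -/
theorem gather_min_of_no_inversion {N : ℕ} (K : CompleteBelow N) {w : List Alph} {a b : Alph}
    (hw : ∀ y ∈ w, y = a ∨ b ≤ y) (hab : a < b) (hbw : b ∈ w) (hinv : ¬ [b, a].Sublist w)
    (hN : w.length ≤ N) :
    HypoEq w (List.replicate (w.count a) a ++ w.filter (· ≠ a)) := by
  obtain ⟨r, q, rfl, hr⟩ := List.eq_append_cons_of_mem hbw
  have haq : a ∉ q := fun haq => hinv (by simp [haq])
  have h := K.gather_min_left (r := r) (q := q) (a := a) (b := b)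
    (fun y hy => (hw y (by simp [hy])).imp_right fun h => h.lt_of_ne (by rintro rfl; exact hr hy))
    hab (fun z hz => (hw z (by simp [hz])).elim (fun h => h.ge) fun h => hab.le.trans h)
    (by simp at hN; omega)
  have hf : q.filter (fun x => !decide (x = a)) = q :=
    List.filter_eq_self.2 fun z hz => by simpa using fun h : z = a => haq (h ▸ hz)
  simpa [List.count_append, List.count_eq_zero_of_not_mem haq, hab.ne', hf] using h

end CompleteBelow

theorem SameInv.filter_min {w v : List Alph} {a : Alph} (h : SameInv w v)
    (ha : ∀ y ∈ w, a ≤ y) : SameInv (w.filter (· ≠ a)) (v.filter (· ≠ a)) := by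
  refine ⟨h.1.filter _, fun i j hij hk => ?_⟩
  have key : ∀ u : List Alph, [j, i].Sublist (u.filter (· ≠ a)) ↔
      [j, i].Sublist u ∧ j ≠ a ∧ i ≠ a := by
    intro u
    constructor
    · intro hs
      have h₁ := hs.subset (show j ∈ [j, i] by simp)
      have h₂ := hs.subset (show i ∈ [j, i] by simp)
      simp only [List.mem_filter, decide_eq_true_eq] at h₁ h₂
      exact ⟨hs.trans List.filter_sublist, h₁.2, h₂.2⟩
    · rintro ⟨hs, hj, hi⟩
      simpa [hj, hi] using hs.filter (· ≠ a)
  rw [key, key]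
  by_cases hi : a ≤ i
  · rw [h.2 i j hij fun k hkw hk' => hk k
      (List.mem_filter.2 ⟨hkw, by simpa using (hi.trans_lt hk'.1).ne'⟩) hk']
  · have hi' : ∀ u : List Alph, u.Perm w → ¬ [j, i].Sublist u := fun u hu hs =>
      hi (ha i (hu.mem_iff.1 (hs.subset (by simp))))
    simp [hi' w (List.Perm.refl w), hi' v h.1.symm]

theorem exists_min_of_ne_nil {l : List Alph} (h : l ≠ []) : ∃ a ∈ l, ∀ y ∈ l, a ≤ y := by
  have hne : l.toFinset.Nonempty := by
    obtain ⟨x, hx⟩ := List.exists_mem_of_ne_nil l h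
    exact ⟨x, by simpa using hx⟩
  obtain ⟨a, ha, hmin⟩ := l.toFinset.exists_min_image id hne
  exact ⟨a, by simpa using ha, fun y hy => hmin y (by simpa using hy)⟩

theorem completeBelow (N : ℕ) : CompleteBelow N := by
  induction N with
  | zero => intro u v hu; simp at hu
  | succ N K =>
    intro w v hN h
    rcases eq_or_ne w [] with rfl | hw
    · rw [List.nil_perm.1 h.1]
      exact HypoEq.refl _
    obtain ⟨a, haw, hmin⟩ := exists_min_of_ne_nil hw
    rcases eq_or_ne (w.filter (· ≠ a)) [] with hf | hf
    · have hwa : w = List.replicate w.length a :=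
        List.eq_replicate_iff.2 ⟨rfl, fun y hy => by simpa using List.filter_eq_nil_iff.1 hf y hy⟩
      have hv := h.1
      rw [hwa] at hv ⊢
      rw [List.replicate_perm.1 hv]
      exact HypoEq.refl _
    obtain ⟨b, hbf, hbmin⟩ := exists_min_of_ne_nil hf
    obtain ⟨hbw, hba⟩ : b ∈ w ∧ b ≠ a := by simpa using hbf
    have hab : a < b := (hmin b hbw).lt_of_ne hba.symm
    have hw' : ∀ y ∈ w, y = a ∨ b ≤ y := fun y hy =>
      or_iff_not_imp_left.2 fun hya => hbmin y (List.mem_filter.2 ⟨hy, by simpa using hya⟩)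
    have hv' : ∀ y ∈ v, y = a ∨ b ≤ y := fun y hy => hw' y (h.1.mem_iff.2 hy)
    have hvN : v.length ≤ N := h.1.length_eq ▸ Nat.lt_succ_iff.1 hN
    have hff : HypoEq (w.filter (· ≠ a)) (v.filter (· ≠ a)) := by
      refine K _ _ ?_ (h.filter_min hmin)
      have : (w.filter (· ≠ a)).length < w.length :=
        List.length_filter_lt_length_iff_exists.2 ⟨a, haw, by simp⟩
      omega
    have hcount : w.count a = v.count a := h.1.count_eq a
    have hinv := h.2 a b hab fun k hk hk' => (hw' k hk).elim (fun h => hk'.1.ne' h)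
      fun h => hk'.2.not_ge h
    by_cases hi : [b, a].Sublist w
    · have h₁ := K.gather_min_of_inversion hw' hab hi (by omega)
      have h₂ := K.gather_min_of_inversion hv' hab (hinv.1 hi) hvN
      rw [← hcount] at h₂
      exact (h₁.trans (hff.append_right _)).trans h₂.symm
    · have h₁ := K.gather_min_of_no_inversion hw' hab hbw hi (by omega)
      have h₂ := K.gather_min_of_no_inversion hv' hab (h.1.mem_iff.1 hbw) (mt hinv.2 hi) hvN
      rw [← hcount] at h₂
      exact (h₁.trans (hff.append_left _)).trans h₂.symm

/-- The congruence of words with the same invariants. -/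
def sameInvCon : Con (FreeMonoid Alph) where
  r u v := SameInv u.toList v.toList
  iseqv := ⟨fun _ => SameInv.refl _, SameInv.symm, SameInv.trans⟩
  mul' h h' := SameInv.append h h'

theorem sameInv_of_hypoRel {u v : FreeMonoid Alph} (h : HypoRel u v) :
    SameInv u.toList v.toList := by
  rcases h with ⟨a, b, c, h₁, h₂, rfl, rfl⟩ | ⟨a, b, c, h₁, h₂, rfl, rfl⟩ |
    ⟨a, b, c, d, h₁, h₂, h₃, rfl, rfl⟩ | ⟨a, b, c, d, h₁, h₂, h₃, rfl, rfl⟩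
  · exact SameInv.swap (p := []) (q := [b]) (h₁.trans_lt h₂) (Or.inr ⟨b, by simp, h₁, h₂⟩)
  · exact SameInv.swap (p := [b]) (q := []) (h₁.trans_le h₂) (Or.inl ⟨b, by simp, h₁, h₂⟩)
  · exact (SameInv.swap (p := []) (q := [d, b]) (h₁.trans_lt h₂)
      (Or.inr ⟨b, by simp, h₁, h₂⟩)).symm.trans
      (SameInv.swap (p := [a, c]) (q := []) (h₂.trans_le h₃) (Or.inl ⟨c, by simp, h₂, h₃⟩)).symm
  · exact (SameInv.swap (p := []) (q := [a, c]) (h₂.trans_lt h₃)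
      (Or.inr ⟨c, by simp, h₂, h₃⟩)).trans
      (SameInv.swap (p := [d, b]) (q := []) (h₁.trans_le h₂) (Or.inl ⟨b, by simp, h₁, h₂⟩))

/-- Hypoplactic equality is equality of contents and of consecutive inversions. -/
theorem hypoEq_iff_sameInv {u v : List Alph} : HypoEq u v ↔ SameInv u v :=
  ⟨fun h => (Con.conGen_le (c := sameInvCon)).2 (fun _ _ h => sameInv_of_hypoRel h) h,
    fun h => completeBelow (u.length + 1) u v (Nat.lt_succ_self _) h⟩

/-- The word over `{1, 2}` that represents `φ_{ij}` of a letter. -/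
def phiLetter (i j a : Alph) : List Alph :=
  if a = i then [1] else if a = j then [2] else if i < a ∧ a < j then [2, 1] else []

theorem phi_eq_iff (i j : Alph) (u v : FreeMonoid Alph) :
    phi i j u = phi i j v ↔
      HypoEq (u.toList.flatMap (phiLetter i j)) (v.toList.flatMap (phiLetter i j)) := by
  let P : FreeMonoid Alph →* FreeMonoid (AlphN 2) := FreeMonoid.lift fun a =>
    if a = i then of a1 else if a = j then of a2 else if i < a ∧ a < j then of a2 * of a1 else 1
  have hphi : phi i j = (hypoConN 2).mk'.comp P := by
    refine FreeMonoid.hom_eq fun a => ?_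
    simp only [phi, P, MonoidHom.comp_apply, FreeMonoid.lift_eval_of]
    split_ifs <;> simp
  have hP : ∀ w : FreeMonoid Alph,
      inclN 2 (P w) = ofList (w.toList.flatMap (phiLetter i j)) := by
    intro w
    induction w using FreeMonoid.inductionOn' with
    | one => rfl
    | of_mul a w ih =>
      rw [map_mul, map_mul, ih, toList_mul, toList_of, List.flatMap_append, ofList_append]
      congr 1
      simp only [P, FreeMonoid.lift_eval_of, List.flatMap_singleton, phiLetter]
      split_ifs <;> rfl
  rw [hphi]
  change ((hypoConN 2).mk' (P u) = (hypoConN 2).mk' (P v)) ↔ _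
  rw [HypoEq, ← hP, ← hP]
  exact (hypoConN 2).eq

theorem mem_flatMap_phiLetter {i j x : Alph} {u : List Alph}
    (h : x ∈ u.flatMap (phiLetter i j)) : x = 1 ∨ x = 2 := by
  obtain ⟨a, -, ha⟩ := List.mem_flatMap.1 h
  unfold phiLetter at ha
  split_ifs at ha <;> simp at ha <;> tauto

theorem eq_of_pair_sublist_flatMap_phiLetter {i j x y : Alph} {u : List Alph} (hxy : x < y)
    (h : [y, x].Sublist (u.flatMap (phiLetter i j))) : x = 1 ∧ y = 2 := by
  have hx := mem_flatMap_phiLetter (h.subset (show x ∈ [y, x] by simp))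
  have hy := mem_flatMap_phiLetter (h.subset (show y ∈ [y, x] by simp))
  have h12 : (1 : Alph) < 2 := by decide
  rcases hx with rfl | rfl <;> rcases hy with rfl | rfl
  · exact absurd hxy (lt_irrefl _)
  · exact ⟨rfl, rfl⟩
  · exact absurd hxy h12.not_gt
  · exact absurd hxy (lt_irrefl _)

theorem one_mem_flatMap_phiLetter {i j : Alph} {u : List Alph} :
    1 ∈ u.flatMap (phiLetter i j) ↔ i ∈ u ∨ ∃ k ∈ u, i < k ∧ k < j := by
  have key : ∀ a, 1 ∈ phiLetter i j a ↔ a = i ∨ i < a ∧ a < j := by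
    intro a
    have h12 : (1 : Alph) ≠ 2 := by decide
    unfold phiLetter
    split_ifs with h₁ h₂ h₃ <;> simp_all
  simp only [List.mem_flatMap, key]
  constructor
  · rintro ⟨a, ha, rfl | h⟩
    · exact Or.inl ha
    · exact Or.inr ⟨a, ha, h⟩
  · rintro (h | ⟨k, hk, h⟩)
    · exact ⟨i, h, Or.inl rfl⟩
    · exact ⟨k, hk, Or.inr h⟩

theorem inversion_flatMap_phiLetter {i j : Alph} (hij : i < j) (u : List Alph) :
    [2, 1].Sublist (u.flatMap (phiLetter i j)) ↔
      [j, i].Sublist u ∨ ∃ k ∈ u, i < k ∧ k < j := by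
  induction u with
  | nil => simp
  | cons a u ih =>
    have h12 : (2 : Alph) ≠ 1 := by decide
    rw [List.flatMap_cons, pair_sublist_append, ih, one_mem_flatMap_phiLetter, pair_sublist_cons]
    have h₁ : [2, 1].Sublist (phiLetter i j a) ↔ i < a ∧ a < j := by
      unfold phiLetter
      split_ifs with h₁ h₂ h₃ <;> simp_all
    have h₂ : 2 ∈ phiLetter i j a ↔ a = j ∨ i < a ∧ a < j := by
      unfold phiLetter
      split_ifs with h₁ h₂ h₃ <;> simp_all [hij.ne]
    rw [h₁, h₂]
    simp only [List.mem_cons, exists_eq_or_imp]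
    have hcomm : a = j ↔ j = a := eq_comm
    generalize (∃ k ∈ u, i < k ∧ k < j) = Q at *
    generalize (i < a ∧ a < j) = R at *
    clear h₁ h₂ ih
    grind

theorem SameInv.flatMap_phiLetter {i j : Alph} (hij : i < j) {u v : List Alph}
    (h : SameInv u v) :
    SameInv (u.flatMap (phiLetter i j)) (v.flatMap (phiLetter i j)) := by
  refine ⟨h.1.flatMap_right _, fun x y hxy _ => ?_⟩
  by_cases hx : x = 1 ∧ y = 2
  · obtain ⟨rfl, rfl⟩ := hx
    rw [inversion_flatMap_phiLetter hij, inversion_flatMap_phiLetter hij]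
    have hmem : (∃ k ∈ u, i < k ∧ k < j) ↔ ∃ k ∈ v, i < k ∧ k < j := by
      simp only [h.1.mem_iff]
    rw [hmem]
    by_cases hk : ∃ k ∈ v, i < k ∧ k < j
    · simp [hk]
    · rw [h.2 i j hij fun k hku hk' => hk ⟨k, h.1.mem_iff.1 hku, hk'⟩]
  · exact iff_of_false (fun hs => hx (eq_of_pair_sublist_flatMap_phiLetter hxy hs))
      fun hs => hx (eq_of_pair_sublist_flatMap_phiLetter hxy hs)

theorem count_flatMap_phiLetter {i j : Alph} (hij : i < j) (hcov : ∀ k, ¬ (i < k ∧ k < j))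
    (u : List Alph) :
    (u.flatMap (phiLetter i j)).count 1 = u.count i ∧
      (u.flatMap (phiLetter i j)).count 2 = u.count j := by
  have h12 : (1 : Alph) ≠ 2 := by decide
  induction u with
  | nil => simp
  | cons a u ih =>
    rw [List.flatMap_cons, List.count_append, List.count_append, ih.1, ih.2, List.count_cons,
      List.count_cons]
    have hij' := hij.ne
    simp only [phiLetter, hcov a, if_false]
    clear hcov
    split_ifs <;> simp_all [add_comm]

theorem sameInv_of_flatMap_phiLetter {n : ℕ} (hn : 2 ≤ n) {u v : List Alph}
    (hu : ∀ x ∈ u, (x : ℕ) ≤ n) (hv : ∀ x ∈ v, (x : ℕ) ≤ n)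
    (h : ∀ i j : Alph, i < j → (j : ℕ) ≤ n →
      SameInv (u.flatMap (phiLetter i j)) (v.flatMap (phiLetter i j))) :
    SameInv u v := by
  have hperm : u.Perm v := by
    rw [List.perm_iff_count]
    intro x
    rcases lt_trichotomy (x : ℕ) n with hx | hx | hx
    · have hlt : x < x + 1 := PNat.lt_add_right x 1
      have hcov : ∀ k, ¬ (x < k ∧ k < x + 1) := fun k hk =>
        absurd (PNat.lt_add_one_iff.1 hk.2) hk.1.not_ge
      rw [← (count_flatMap_phiLetter hlt hcov u).1, ← (count_flatMap_phiLetter hlt hcov v).1]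
      exact (h x (x + 1) hlt (by simpa using hx)).1.count_eq 1
    · obtain ⟨y, rfl⟩ := PNat.exists_eq_succ_of_ne_one (n := x)
        (by rintro rfl; simp at hx; omega)
      have hlt : y < y + 1 := PNat.lt_add_right y 1
      have hcov : ∀ k, ¬ (y < k ∧ k < y + 1) := fun k hk =>
        absurd (PNat.lt_add_one_iff.1 hk.2) hk.1.not_ge
      rw [← (count_flatMap_phiLetter hlt hcov u).2, ← (count_flatMap_phiLetter hlt hcov v).2]
      exact (h y (y + 1) hlt hx.le).1.count_eq 2
    · rw [List.count_eq_zero_of_not_mem fun hm => hx.not_ge (hu x hm),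
        List.count_eq_zero_of_not_mem fun hm => hx.not_ge (hv x hm)]
  refine ⟨hperm, fun i j hij hk => ?_⟩
  by_cases hj : (j : ℕ) ≤ n
  · have h12 := (h i j hij hj).2 1 2 (by decide) fun k _ hk =>
      absurd (PNat.lt_add_one_iff.1 (show k < 1 + 1 from hk.2)) hk.1.not_ge
    rw [inversion_flatMap_phiLetter hij, inversion_flatMap_phiLetter hij] at h12
    have hu' : ¬ ∃ k ∈ u, i < k ∧ k < j := fun ⟨k, hku, hk'⟩ => hk k hku hk'
    have hv' : ¬ ∃ k ∈ v, i < k ∧ k < j := fun ⟨k, hkv, hk'⟩ => hk k (hperm.mem_iff.2 hkv) hk'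
    simpa [hu', hv'] using h12
  · exact iff_of_false (fun hs => hj (hu j (hs.subset (by simp))))
      fun hs => hj (hv j (hs.subset (by simp)))

theorem card_pairs (n : ℕ) :
    Nat.card {p : Alph × Alph // p.1 < p.2 ∧ (p.2 : ℕ) ≤ n} = n * (n - 1) / 2 := by
  let e : {p : Alph × Alph // p.1 < p.2 ∧ (p.2 : ℕ) ≤ n} ≃ (j : Fin n) × Fin j :=
    { toFun := fun p => ⟨⟨p.1.2.natPred, by
          have := p.1.2.natPred_add_one; have := p.2.2; omega⟩,
        ⟨p.1.1.natPred, PNat.natPred_lt_natPred.2 p.2.1⟩⟩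
      invFun := fun q => ⟨(q.2.1.succPNat, q.1.1.succPNat),
        Nat.succPNat_lt_succPNat.2 q.2.2, q.1.2⟩
      left_inv := fun p => by simp
      right_inv := fun q => by simp }
  rw [Nat.card_congr e, Nat.card_eq_fintype_card, Fintype.card_sigma]
  simp only [Fintype.card_fin]
  rw [Fin.sum_univ_eq_sum_range (fun k => k) n, Finset.sum_range_id]

/-- For every `n ≥ 2`, the map `φ_n` from `hypo_n` to the direct product of copies
of `hypo_2` indexed by pairs `(i,j)` with `1 ≤ i < j ≤ n`, whose `(i,j)`-th component
sends `[w]` to `φ_{ij}(w)`, is a well-defined injective monoid homomorphism; the index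
set has exactly `n(n-1)/2` elements, so `hypo_n` embeds into a direct product of
`n(n-1)/2` copies of `hypo_2`. -/
theorem hypoN_embeds_prod_hypo2 (n : ℕ) (hn : 2 ≤ n) :
    (∃ f : HypoN n →* ({p : Alph × Alph // p.1 < p.2 ∧ (p.2 : ℕ) ≤ n} → HypoN 2),
      (∀ (w : FreeMonoid (AlphN n)) (p : {p : Alph × Alph // p.1 < p.2 ∧ (p.2 : ℕ) ≤ n}),
        f ((hypoConN n).mk' w) p = phi p.1.1 p.1.2 (inclN n w)) ∧
      Function.Injective f) ∧
    Nat.card {p : Alph × Alph // p.1 < p.2 ∧ (p.2 : ℕ) ≤ n} = n * (n - 1) / 2 := by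
  have hrel : ∀ u v : FreeMonoid (AlphN n), hypoConN n u v ↔
      ∀ p : {p : Alph × Alph // p.1 < p.2 ∧ (p.2 : ℕ) ≤ n},
        phi p.1.1 p.1.2 (inclN n u) = phi p.1.1 p.1.2 (inclN n v) := by
    intro u v
    have hle : ∀ w : FreeMonoid (AlphN n), ∀ x ∈ (inclN n w).toList, (x : ℕ) ≤ n := by
      intro w x hx
      obtain ⟨y, -, rfl⟩ := List.mem_map.1 (show x ∈ w.toList.map Subtype.val from hx)
      exact y.2
    change HypoEq (inclN n u).toList (inclN n v).toList ↔ _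
    simp only [phi_eq_iff, hypoEq_iff_sameInv]
    exact ⟨fun h p => h.flatMap_phiLetter p.2.1, fun h =>
      sameInv_of_flatMap_phiLetter hn (hle u) (hle v) fun i j hij hj => h ⟨(i, j), hij, hj⟩⟩
  let g : FreeMonoid (AlphN n) →*
      ({p : Alph × Alph // p.1 < p.2 ∧ (p.2 : ℕ) ≤ n} → HypoN 2) :=
    MonoidHom.pi fun p => (phi p.1.1 p.1.2).comp (inclN n)
  have hg : hypoConN n ≤ Con.ker g := fun {u v} h => funext ((hrel u v).1 h)
  refine ⟨⟨(hypoConN n).lift g hg, fun w p => rfl, fun x y => ?_⟩, card_pairs n⟩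
  induction x, y using Con.induction_on₂ with
  | _ u v => exact fun h => (hypoConN n).eq.2 ((hrel u v).2 fun p => congrFun h p)
end

section
/- The monoid homomorphism φ from the infinite-rank hypoplactic monoid hypo to the direct product of the family (hypo_2) indexed by all pairs (i, j) of positive integers with i < j, whose (i, j)-th component sends the class [w] to φ_ij(w), is well defined and injective. Hence hypo embeds into a direct product of infinitely many copies of hypo_2. -/
open FreeMonoid

namespace Hypoplactic

section Swaps

variable {α M : Type*} [Monoid M]

/-- The value of a word under the extension of `f` to words. -/
def wordVal (f : α → M) (t : List α) : M := (t.map f).prod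

@[simp] theorem wordVal_nil (f : α → M) : wordVal f [] = 1 := rfl

@[simp] theorem wordVal_cons (f : α → M) (a : α) (t : List α) :
    wordVal f (a :: t) = f a * wordVal f t := by simp [wordVal]

@[simp] theorem wordVal_append (f : α → M) (s t : List α) :
    wordVal f (s ++ t) = wordVal f s * wordVal f t := by simp [wordVal]

/-- The map dual to `f`, for the reversed alphabet and the opposite monoid. -/
def dualMap (f : α → M) (a : αᵒᵈ) : Mᵐᵒᵖ := MulOpposite.op (f (OrderDual.ofDual a))

theorem unop_wordVal_dualMap (f : α → M) (t : List αᵒᵈ) :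
    (wordVal (dualMap f) t).unop = wordVal f (t.map OrderDual.ofDual).reverse := by
  induction t with
  | nil => rfl
  | cons a t ih => simp [ih, dualMap]

variable [LinearOrder α]

/-- The map `f` satisfies the defining relations of the hypoplactic monoid. -/
structure Respects (f : α → M) : Prop where
  acb : ∀ ⦃a b c : α⦄, a ≤ b → b < c → f a * f c * f b = f c * f a * f b
  bac : ∀ ⦃a b c : α⦄, a < b → b ≤ c → f b * f a * f c = f b * f c * f a
  cadb : ∀ ⦃a b c d : α⦄, a ≤ b → b < c → c ≤ d →
    f c * f a * f d * f b = f a * f c * f b * f d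
  bdac : ∀ ⦃a b c d : α⦄, a < b → b ≤ c → c < d →
    f b * f d * f a * f c = f d * f b * f c * f a

/-- Adjacent letters `x < y` commute when a letter in `(x, y]` occurs before them, at
distance `n`. -/
def LSwap (f : α → M) (n : ℕ) : Prop :=
  ∀ ⦃x m y : α⦄ (t : List α) (r : M), t.length = n → x < m → m ≤ y →
    f m * (wordVal f t * (f x * (f y * r))) = f m * (wordVal f t * (f y * (f x * r)))

/-- Adjacent letters `x < y` commute when a letter in `[x, y)` occurs after them, at
distance `n`. -/
def RSwap (f : α → M) (n : ℕ) : Prop :=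
  ∀ ⦃x m y : α⦄ (t : List α) (r : M), t.length = n → x ≤ m → m < y →
    f x * (f y * (wordVal f t * (f m * r))) = f y * (f x * (wordVal f t * (f m * r)))

theorem Respects.dual {f : α → M} (hf : Respects f) : Respects (dualMap f) where
  acb a b c h₁ h₂ := MulOpposite.unop_injective <| by
    simpa [dualMap, mul_assoc] using
      hf.bac (a := c.ofDual) (b := b.ofDual) (c := a.ofDual) h₂ h₁
  bac a b c h₁ h₂ := MulOpposite.unop_injective <| by
    simpa [dualMap, mul_assoc] using
      hf.acb (a := c.ofDual) (b := b.ofDual) (c := a.ofDual) h₂ h₁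
  cadb a b c d h₁ h₂ h₃ := MulOpposite.unop_injective <| by
    simpa [dualMap, mul_assoc] using
      hf.cadb (a := d.ofDual) (b := c.ofDual) (c := b.ofDual) (d := a.ofDual) h₃ h₂ h₁
  bdac a b c d h₁ h₂ h₃ := MulOpposite.unop_injective <| by
    simpa [dualMap, mul_assoc] using
      hf.bdac (a := d.ofDual) (b := c.ofDual) (c := b.ofDual) (d := a.ofDual) h₃ h₂ h₁

theorem LSwap.dual {f : α → M} {n : ℕ} (h : LSwap f n) : RSwap (dualMap f) n := by
  intro x m y t r ht h₁ h₂
  apply MulOpposite.unop_injective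
  have := h (x := y.ofDual) (m := m.ofDual) (y := x.ofDual) (t.map OrderDual.ofDual).reverse 1
    (by simpa using ht) h₂ h₁
  simpa [unop_wordVal_dualMap, dualMap, mul_assoc] using congrArg (r.unop * ·) this

theorem RSwap.dual {f : α → M} {n : ℕ} (h : RSwap f n) : LSwap (dualMap f) n := by
  intro x m y t r ht h₁ h₂
  apply MulOpposite.unop_injective
  have := h (x := y.ofDual) (m := m.ofDual) (y := x.ofDual) (t.map OrderDual.ofDual).reverse 1
    (by simpa using ht) h₂ h₁
  simpa [unop_wordVal_dualMap, dualMap, mul_assoc] using congrArg (r.unop * ·) this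

theorem LSwap.of_dual {f : α → M} {n : ℕ} (h : RSwap (dualMap f) n) : LSwap f n := by
  intro x m y t r ht h₁ h₂
  have := congrArg MulOpposite.unop
    (h (x := OrderDual.toDual y) (m := OrderDual.toDual m) (y := OrderDual.toDual x)
      (t.map OrderDual.toDual).reverse 1 (by simpa using ht) h₂ h₁)
  simpa [unop_wordVal_dualMap, dualMap, mul_assoc, Function.comp_def]
    using congrArg (· * r) this

theorem wordVal_swap_letter {f : α → M} {n : ℕ} (hL : ∀ k < n, LSwap f k) (p y : α)
    (hy : p ≤ y) (r : M) (s : List α) (hs : ∀ k ∈ s, k < p) (q : List α)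
    (hlen : q.length + s.length ≤ n) :
    f p * (wordVal f q * (wordVal f s * (f y * r))) =
      f p * (wordVal f q * (f y * (wordVal f s * r))) := by
  induction s generalizing q with
  | nil => simp
  | cons x s ih =>
    simp only [List.length_cons, List.mem_cons, forall_eq_or_imp] at hlen hs
    have h₁ := ih hs.2 (q ++ [x]) (by simp; omega)
    have h₂ := hL q.length (by omega) q (wordVal f s * r) rfl hs.1 hy
    simp only [wordVal_append, wordVal_cons, wordVal_nil, mul_assoc, one_mul] at h₁ ⊢
    rw [h₁, h₂]

theorem wordVal_swap_block {f : α → M} {n : ℕ} (hL : ∀ k < n, LSwap f k) (p : α)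
    (s : List α) (hs : ∀ k ∈ s, k < p) (u : List α) (hu : ∀ k ∈ u, p ≤ k) (q : List α) (r : M)
    (hlen : q.length + s.length + u.length ≤ n + 1) :
    f p * (wordVal f q * (wordVal f s * (wordVal f u * r))) =
      f p * (wordVal f q * (wordVal f u * (wordVal f s * r))) := by
  induction u generalizing q with
  | nil => simp
  | cons y u ih =>
    simp only [List.length_cons, List.mem_cons, forall_eq_or_imp] at hlen hu
    have h₁ := ih hu.2 (q ++ [y]) (by simp; omega)
    have h₂ := wordVal_swap_letter hL p y hu.1 (wordVal f u * r) s hs q (by omega)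
    simp only [wordVal_append, wordVal_cons, wordVal_nil, mul_assoc, one_mul] at h₁ ⊢
    rw [h₂, h₁]

theorem wordVal_sort {f : α → M} {n : ℕ} (hL : ∀ k < n, LSwap f k) (p : α)
    (t : List α) (q : List α) (r : M) (hlen : q.length + t.length ≤ n + 1) :
    f p * (wordVal f q * (wordVal f t * r)) =
      f p * (wordVal f q * (wordVal f (t.filter (· < p)) *
        (wordVal f (t.filter (p ≤ ·)) * r))) := by
  induction t generalizing q with
  | nil => simp
  | cons x t ih =>
    simp only [List.length_cons] at hlen
    have h₁ := ih (q ++ [x]) (by simp; omega)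
    simp only [wordVal_append, wordVal_cons, wordVal_nil, mul_assoc, one_mul] at h₁ ⊢
    rw [h₁]
    by_cases hx : x < p
    · simp [hx, hx.not_ge, mul_assoc]
    · have hlen' := List.length_filter_le (fun k => decide (k < p)) t
      have h₂ := wordVal_swap_block hL p (t.filter (· < p)) (by simp) [x] (by simpa using hx) q
        (wordVal f (t.filter (p ≤ ·)) * r) (by simp; omega)
      simp only [wordVal_cons, wordVal_nil, mul_one] at h₂
      simp [hx, not_lt.1 hx, mul_assoc, h₂]

theorem RSwap.zero {f : α → M} (hf : Respects f) : RSwap f 0 := by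
  intro x m y t r ht h₁ h₂
  obtain rfl := List.length_eq_zero_iff.1 ht
  simpa [mul_assoc] using congrArg (· * r) (hf.acb h₁ h₂)

theorem RSwap.one {f : α → M} (hf : Respects f) : RSwap f 1 := by
  intro x m y t r ht h₁ h₂
  obtain ⟨k, rfl⟩ := List.length_eq_one_iff.1 ht
  simp only [wordVal_cons, wordVal_nil, mul_one]
  rcases lt_or_ge k x with hk | hk
  · have e₁ := congrArg (· * r) (hf.bdac hk h₁ h₂)
    have e₂ := congrArg (· * r) (hf.bac hk h₁)
    simp only [mul_assoc] at e₁ e₂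
    rw [e₁, e₂]
  · rcases lt_or_ge k y with hk' | hk'
    · simpa using RSwap.zero hf [] (f m * r) rfl hk hk'
    · have e₁ := congrArg (· * r) (hf.cadb h₁ h₂ hk')
      have e₂ := congrArg (· * r) (hf.bac h₂ hk')
      simp only [mul_assoc] at e₁ e₂
      rw [e₁, e₂]

/-- The case of `RSwap` in which all letters in between are at least `y`. -/
theorem rSwap_of_forall_ge {f : α → M} {n : ℕ} (hn : 2 ≤ n) (hL : ∀ k < n, LSwap f k)
    (hR : ∀ k < n, RSwap f k) {x m y : α} (h₁ : x ≤ m) (h₂ : m < y) (t : List α) (r : M)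
    (ht : t.length = n) (hge : ∀ k ∈ t, y ≤ k) :
    f x * (f y * (wordVal f t * (f m * r))) = f y * (f x * (wordVal f t * (f m * r))) := by
  obtain _ | ⟨h, t⟩ := t
  · simp at ht; omega
  simp only [List.length_cons, List.mem_cons, forall_eq_or_imp] at ht hge
  have hxy : x < y := h₁.trans_lt h₂
  by_cases H : ∃ k ∈ t, k < h
  · obtain ⟨k, hk, hkh⟩ := H
    have hyk := hge.2 k hk
    obtain ⟨t₁, t₂, rfl⟩ := List.append_of_mem hk
    simp only [List.length_append, List.length_cons] at ht
    have e₁ := hR t₁.length (by omega) t₁ (wordVal f t₂ * (f m * r)) rfl hyk hkh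
    have e₂ := hR 0 (by omega) [] (wordVal f (t₁ ++ k :: t₂) * (f m * r)) rfl hxy.le
      (hyk.trans_lt hkh)
    have e₃ := hR (t₁ ++ k :: t₂).length (by simp; omega) (t₁ ++ k :: t₂) r rfl h₁ h₂
    have e₄ := hR (x :: t₁).length (by simp; omega) (x :: t₁) (wordVal f t₂ * (f m * r)) rfl
      hyk hkh
    have e₅ := hL 0 (by omega) [] (wordVal f (t₁ ++ k :: t₂) * (f m * r)) rfl hxy hge.1
    simp only [wordVal_append, wordVal_cons, wordVal_nil, mul_assoc, one_mul] at e₂ e₃ e₄ e₅ ⊢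
    rw [e₁, e₂, e₃, ← e₄, e₅]
  · push Not at H
    have e₁ := wordVal_swap_block hL h [m] (by simpa using h₂.trans_le hge.1) t H [] r
      (by simp; omega)
    have e₂ := hR 1 (by omega) [h] (wordVal f t * r) rfl h₁ h₂
    simp only [wordVal_cons, wordVal_nil, mul_assoc, one_mul] at e₁ e₂ ⊢
    rw [← e₁, e₂]

/-- The case of `RSwap` in which all letters in between are smaller than `x`. -/
theorem rSwap_of_forall_lt {f : α → M} {n : ℕ} (hn : 2 ≤ n) (hL : ∀ k < n, LSwap f k)
    (hR : ∀ k < n, RSwap f k) {x m y : α} (h₁ : x ≤ m) (h₂ : m < y) (t : List α) (r : M)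
    (ht : t.length = n) (hlt : ∀ k ∈ t, k < x) :
    f x * (f y * (wordVal f t * (f m * r))) = f y * (f x * (wordVal f t * (f m * r))) := by
  obtain _ | ⟨w, t⟩ := t
  · simp at ht; omega
  simp only [List.length_cons, List.mem_cons, forall_eq_or_imp] at ht hlt
  have hxy : x < y := h₁.trans_lt h₂
  by_cases H : ∃ k ∈ t, w ≤ k
  · obtain ⟨k, hk, hwk⟩ := H
    have hkx := hlt.2 k hk
    obtain ⟨t₁, t₂, rfl⟩ := List.append_of_mem hk
    simp only [List.length_append, List.length_cons] at ht
    have e₁ := hL 0 (by omega) [] (wordVal f (t₁ ++ k :: t₂) * (f m * r)) rfl hlt.1 hxy.le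
    have e₂ := hR (y :: t₁).length (by simp; omega) (y :: t₁) (wordVal f t₂ * (f m * r)) rfl
      hwk hkx
    have e₃ := hR (t₁ ++ k :: t₂).length (by simp; omega) (t₁ ++ k :: t₂) r rfl h₁ h₂
    have e₄ := hR 0 (by omega) [] (wordVal f (t₁ ++ k :: t₂) * (f m * r)) rfl hlt.1.le hxy
    have e₅ := hR t₁.length (by omega) t₁ (wordVal f t₂ * (f m * r)) rfl hwk hkx
    simp only [wordVal_append, wordVal_cons, wordVal_nil, mul_assoc, one_mul] at e₁ e₂ e₃ e₄ ⊢
    rw [← e₁, ← e₂, e₃, e₄, e₅]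
  · push Not at H
    have e₁ := wordVal_swap_block hL w t H [m] (by simpa using hlt.1.le.trans h₁) [] r
      (by simp; omega)
    have e₂ := hR 1 (by omega) [w] (wordVal f t * r) rfl h₁ h₂
    simp only [wordVal_cons, wordVal_nil, mul_assoc, one_mul] at e₁ e₂ ⊢
    rw [e₁, e₂]

theorem RSwap.step {f : α → M} {n : ℕ} (hn : 2 ≤ n) (hL : ∀ k < n, LSwap f k)
    (hR : ∀ k < n, RSwap f k) : RSwap f n := by
  intro x m y t r ht h₁ h₂
  have hxy : x < y := h₁.trans_lt h₂
  by_cases H : ∃ k ∈ t, x ≤ k ∧ k < y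
  · obtain ⟨k, hk, hxk, hky⟩ := H
    obtain ⟨t₁, t₂, rfl⟩ := List.append_of_mem hk
    simp only [List.length_append, List.length_cons] at ht
    have e := hR t₁.length (by omega) t₁ (wordVal f t₂ * (f m * r)) rfl hxk hky
    simpa [mul_assoc] using e
  push Not at H
  have s₁ := wordVal_sort hL x t [y] (f m * r) (by simp; omega)
  have s₂ := wordVal_sort hL x t [] (f m * r) (by simp; omega)
  have hlo : ∀ k ∈ t.filter (· < x), k < x := by simp
  have hhi : ∀ k ∈ t.filter (x ≤ ·), y ≤ k := by
    intro k hk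
    simp only [List.mem_filter, decide_eq_true_eq] at hk
    exact H k hk.1 hk.2
  have hlen : (t.filter (· < x)).length + (t.filter (x ≤ ·)).length = n := by
    rw [← ht, t.length_eq_length_filter_add (fun k => decide (k < x))]
    simp [← not_lt]
  simp only [wordVal_cons, wordVal_nil, mul_one, one_mul] at s₁ s₂
  rw [s₁, s₂]
  generalize t.filter (· < x) = lo at *
  generalize t.filter (x ≤ ·) = hi at *
  rcases eq_or_ne lo [] with rfl | hlo'
  · simpa using rSwap_of_forall_ge hn hL hR h₁ h₂ hi r (by simpa using hlen) hhi
  rcases eq_or_ne hi [] with rfl | hhi'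
  · simpa using rSwap_of_forall_lt hn hL hR h₁ h₂ lo r (by simpa using hlen) hlo
  have hlo₀ := List.length_pos_iff.2 hlo'
  have hhi₀ := List.length_pos_iff.2 hhi'
  have hhix : ∀ k ∈ hi, x ≤ k := fun k hk => hxy.le.trans (hhi k hk)
  have e₁ := wordVal_swap_block hL y [m] (by simpa using h₂) hi hhi lo r (by simp; omega)
  have e₂ := hR lo.length (by omega) lo (wordVal f hi * r) rfl h₁ h₂
  have e₃ := wordVal_swap_block hL x lo hlo [m] (by simpa using h₁) [] (wordVal f hi * r)
    (by simp; omega)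
  have e₄ := wordVal_swap_block hL x lo hlo hi hhix [m] r (by simp; omega)
  have e₅ := wordVal_swap_block hL y [m] (by simpa using h₂) hi hhi [x] (wordVal f lo * r)
    (by simp; omega)
  have e₆ := wordVal_swap_block hL x lo hlo [m] (by simpa using h₁) hi r (by simp; omega)
  have e₇ := wordVal_swap_block hL x lo hlo hi hhix [] (f m * r) (by simp; omega)
  simp only [wordVal_cons, wordVal_nil, mul_one, one_mul] at e₁ e₃ e₄ e₅ e₆ e₇
  rw [← e₁, e₂, e₃, e₄, e₅, ← e₆, ← e₇]

theorem swaps {f : α → M} (hf : Respects f) (n : ℕ) : LSwap f n ∧ RSwap f n := by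
  induction n using Nat.strong_induction_on with
  | _ n ih =>
    match n, ih with
    | 0, _ => exact ⟨.of_dual (.zero hf.dual), .zero hf⟩
    | 1, _ => exact ⟨.of_dual (.one hf.dual), .one hf⟩
    | n + 2, ih =>
      exact ⟨.of_dual (.step (by omega) (fun k hk => (ih k hk).2.dual)
        fun k hk => (ih k hk).1.dual),
        .step (by omega) (fun k hk => (ih k hk).1) fun k hk => (ih k hk).2⟩

theorem wordVal_swap_of_mem_left {f : α → M} (hf : Respects f) {x m y : α} (h₁ : x < m)
    (h₂ : m ≤ y) {s : List α} (hm : m ∈ s) (t : List α) :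
    wordVal f (s ++ x :: y :: t) = wordVal f (s ++ y :: x :: t) := by
  obtain ⟨s₁, s₂, rfl⟩ := List.append_of_mem hm
  have e := (swaps hf s₂.length).1 s₂ (wordVal f t) rfl h₁ h₂
  simp [e]

theorem wordVal_swap_of_mem_right {f : α → M} (hf : Respects f) {x m y : α} (h₁ : x ≤ m)
    (h₂ : m < y) (s : List α) {t : List α} (hm : m ∈ t) :
    wordVal f (s ++ x :: y :: t) = wordVal f (s ++ y :: x :: t) := by
  obtain ⟨t₁, t₂, rfl⟩ := List.append_of_mem hm
  have e := (swaps hf t₁.length).2 t₁ (wordVal f t₂) rfl h₁ h₂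
  simp [e]

end Swaps

section Invariants

theorem pair_sublist_append {α : Type*} {i j : α} {u v : List α} :
    [j, i].Sublist (u ++ v) ↔ [j, i].Sublist u ∨ [j, i].Sublist v ∨ (j ∈ u ∧ i ∈ v) := by
  induction u with
  | nil => simp
  | cons a u ih => simp [List.sublist_cons_iff, ih]; grind

variable {α M : Type*} [LinearOrder α] [Monoid M]

/-- The word `w` has a letter strictly between `i` and `j`, or an occurrence of `j` before an
occurrence of `i`. -/
def Separated (i j : α) (w : List α) : Prop := (∃ k ∈ w, i < k ∧ k < j) ∨ [j, i].Sublist w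

/-- The words `u` and `v` have the same content and the same inversions between consecutive
letters of their support. -/
def SameInv (u v : List α) : Prop :=
  u.Perm v ∧ ∀ i j : α, i < j → (Separated i j u ↔ Separated i j v)

theorem separated_append {i j : α} {u v : List α} :
    Separated i j (u ++ v) ↔ Separated i j u ∨ Separated i j v ∨ (j ∈ u ∧ i ∈ v) := by
  simp only [Separated, pair_sublist_append, List.mem_append]
  grind

theorem SameInv.refl (u : List α) : SameInv u u := ⟨.refl u, fun _ _ _ => Iff.rfl⟩

theorem SameInv.symm {u v : List α} (h : SameInv u v) : SameInv v u :=
  ⟨h.1.symm, fun i j hij => (h.2 i j hij).symm⟩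

theorem SameInv.trans {u v w : List α} (h : SameInv u v) (h' : SameInv v w) : SameInv u w :=
  ⟨h.1.trans h'.1, fun i j hij => (h.2 i j hij).trans (h'.2 i j hij)⟩

theorem SameInv.append {u v u' v' : List α} (h : SameInv u v) (h' : SameInv u' v') :
    SameInv (u ++ u') (v ++ v') :=
  ⟨h.1.append h'.1, fun i j hij => by
    rw [separated_append, separated_append, h.2 i j hij, h'.2 i j hij, h.1.mem_iff, h'.1.mem_iff]⟩

/-- A letter can be moved to the front of the part of a word in which it differs from an
equivalent one. -/
theorem wordVal_move_front {f : α → M} (hf : Respects f)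
    (hs : ∀ u v, wordVal f u = wordVal f v → SameInv u v) (p : List α) (x : α) (v : List α)
    (s : List α) (hx : x ∉ s) (t : List α) (h : SameInv (p ++ (s ++ x :: t)) (p ++ x :: v)) :
    wordVal f (p ++ (s ++ x :: t)) = wordVal f (p ++ x :: (s ++ t)) := by
  induction s using List.reverseRecOn generalizing t with
  | nil => rfl
  | append_singleton s y ih =>
    have hxs : x ∉ s := fun h => hx (by simp [h])
    have hxy : x ≠ y := fun h => hx (by simp [h])
    have hperm : (s ++ y :: x :: t).Perm (x :: v) := by
      simpa using (List.perm_append_left_iff p).1 h.1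
    have key : wordVal f ((p ++ s) ++ y :: x :: t) = wordVal f ((p ++ s) ++ x :: y :: t) := by
      rcases lt_or_gt_of_ne hxy with hlt | hlt
      · have hsep := (h.2 x y hlt).1 (by
          right
          simp [List.sublist_cons_iff])
        have hsplit : (∃ k ∈ p ++ s, x < k ∧ k ≤ y) ∨ ∃ k ∈ t, x ≤ k ∧ k < y := by
          rcases hsep with ⟨k, hk, h₁, h₂⟩ | hsub
          · rw [← h.1.mem_iff] at hk
            simp only [List.append_assoc, List.mem_append, List.mem_cons] at hk ⊢
            grind
          · have hcount : x ∈ v → x ∈ t := by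
              intro hv
              have h₁ := hperm.count_eq x
              have h₂ := List.count_pos_iff.2 hv
              have h₃ := List.count_eq_zero.2 hxs
              rw [List.count_append, List.count_cons_of_ne hxy.symm, List.count_cons_self,
                List.count_cons_self] at h₁
              exact List.count_pos_iff.1 (by omega)
            rw [pair_sublist_append] at hsub
            have hyp : y ∈ p ∨ x ∈ v := by
              rcases hsub with h' | h' | h'
              · exact .inl (h'.subset (by simp))
              · rcases List.sublist_cons_iff.1 h' with h' | ⟨r, hr, h'⟩
                · exact .inr (h'.subset (by simp))
                · simp only [List.cons.injEq] at hr
                  exact absurd hr.1 hxy.symm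
              · exact .inl h'.1
            rcases hyp with hyp | hyp
            · exact .inl ⟨y, by simp [hyp], hlt, le_rfl⟩
            · exact .inr ⟨x, hcount hyp, le_rfl, hlt⟩
        rcases hsplit with ⟨k, hk, h₁, h₂⟩ | ⟨k, hk, h₁, h₂⟩
        · exact (wordVal_swap_of_mem_left hf h₁ h₂ hk t).symm
        · exact (wordVal_swap_of_mem_right hf h₁ h₂ (p ++ s) hk).symm
      · have hyv : y ∈ v := by
          have : y ∈ x :: v := hperm.mem_iff.1 (by simp)
          simpa [hxy.symm] using this
        have hsep := (h.2 y x hlt).2 (by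
          right
          simp [List.sublist_cons_iff, hyv])
        have hsplit : (∃ k ∈ p ++ s, y < k ∧ k ≤ x) ∨ ∃ k ∈ t, y ≤ k ∧ k < x := by
          rcases hsep with ⟨k, hk, h₁, h₂⟩ | hsub
          · simp only [List.append_assoc, List.mem_append, List.mem_cons] at hk ⊢
            grind
          · have e : p ++ (s ++ [y] ++ x :: t) = (p ++ s) ++ ([y, x] ++ t) := by simp
            rw [e, pair_sublist_append, pair_sublist_append (u := [y, x])] at hsub
            have hyp : x ∈ p ++ s ∨ y ∈ t := by
              rcases hsub with h' | (h' | h' | h') | h'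
              · exact .inl (h'.subset (by simp))
              · simp [List.sublist_cons_iff, hxy] at h'
              · exact .inr (h'.subset (by simp))
              · exact .inr h'.2
              · exact .inl h'.1
            rcases hyp with hyp | hyp
            · exact .inl ⟨x, hyp, hlt, le_rfl⟩
            · exact .inr ⟨y, hyp, le_rfl, hlt⟩
        rcases hsplit with ⟨k, hk, h₁, h₂⟩ | ⟨k, hk, h₁, h₂⟩
        · exact wordVal_swap_of_mem_left hf h₁ h₂ hk t
        · exact wordVal_swap_of_mem_right hf h₁ h₂ (p ++ s) hk
    have key' : wordVal f (p ++ (s ++ [y] ++ x :: t)) = wordVal f (p ++ (s ++ x :: y :: t)) := by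
      simpa using key
    rw [key', ih hxs (y :: t) ((hs _ _ key').symm.trans h)]
    simp

theorem wordVal_eq_of_sameInv {f : α → M} (hf : Respects f)
    (hs : ∀ u v, wordVal f u = wordVal f v → SameInv u v) (v : List α) (p u : List α)
    (h : SameInv (p ++ u) (p ++ v)) : wordVal f (p ++ u) = wordVal f (p ++ v) := by
  induction v generalizing p u with
  | nil =>
    have : u.Perm [] := (List.perm_append_left_iff p).1 h.1
    rw [this.eq_nil]
  | cons x v ih =>
    have hperm : u.Perm (x :: v) := (List.perm_append_left_iff p).1 h.1
    obtain ⟨s, t, rfl, hx⟩ := List.eq_append_cons_of_mem (hperm.mem_iff.2 (List.mem_cons_self ..))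
    have e := wordVal_move_front hf hs p x v s hx t h
    have := ih (p ++ [x]) (s ++ t) (by simpa using (hs _ _ e).symm.trans h)
    rw [e]
    simpa using this

end Invariants

/-- The congruence on words given by `SameInv`. -/
def sameInvCon : Con (FreeMonoid Alph) where
  r u v := SameInv u.toList v.toList
  iseqv := ⟨fun _ => .refl _, .symm, .trans⟩
  mul' h h' := h.append h'

theorem sameInv_of_hypoRel {u v : FreeMonoid Alph} (h : HypoRel u v) :
    SameInv u.toList v.toList := by
  rcases h with ⟨a, b, c, h₁, h₂, rfl, rfl⟩ | ⟨a, b, c, h₁, h₂, rfl, rfl⟩ |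
    ⟨a, b, c, d, h₁, h₂, h₃, rfl, rfl⟩ | ⟨a, b, c, d, h₁, h₂, h₃, rfl, rfl⟩
  all_goals
    refine ⟨?_, fun i j hij => ?_⟩
    · rw [List.perm_iff_count]
      intro k
      simp [List.count_cons]
      omega
    · simp [Separated, List.sublist_cons_iff]
      grind

theorem sameInv_of_hypoCon {u v : FreeMonoid Alph} (h : hypoCon u v) :
    SameInv u.toList v.toList :=
  (Con.conGen_le (c := sameInvCon)).2 (fun _ _ => sameInv_of_hypoRel) h

/-- The class of a letter. -/
def letter (a : Alph) : Hypo := hypoCon.mk' (of a)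

theorem wordVal_letter (w : List Alph) :
    wordVal letter w = hypoCon.mk' (FreeMonoid.ofList w) := by
  induction w with
  | nil => rfl
  | cons a w ih => rw [wordVal_cons, ih, FreeMonoid.ofList_cons, map_mul]; rfl

theorem respects_letter : Respects letter where
  acb a b c h₁ h₂ := (Con.eq _).2 <| ConGen.Rel.of _ _ <| .inl ⟨a, b, c, h₁, h₂, rfl, rfl⟩
  bac a b c h₁ h₂ := (Con.eq _).2 <| ConGen.Rel.of _ _ <| .inr <| .inl ⟨a, b, c, h₁, h₂, rfl, rfl⟩
  cadb a b c d h₁ h₂ h₃ := (Con.eq _).2 <| ConGen.Rel.of _ _ <|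
    .inr <| .inr <| .inl ⟨a, b, c, d, h₁, h₂, h₃, rfl, rfl⟩
  bdac a b c d h₁ h₂ h₃ := (Con.eq _).2 <| ConGen.Rel.of _ _ <|
    .inr <| .inr <| .inr ⟨a, b, c, d, h₁, h₂, h₃, rfl, rfl⟩

theorem hypoCon_iff_sameInv {u v : FreeMonoid Alph} :
    hypoCon u v ↔ SameInv u.toList v.toList := by
  refine ⟨sameInv_of_hypoCon, fun h => ?_⟩
  have := wordVal_eq_of_sameInv respects_letter
    (fun u v e => sameInv_of_hypoCon (u := .ofList u) (v := .ofList v) <| by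
      rw [wordVal_letter, wordVal_letter] at e
      exact (Con.eq _).1 e) v.toList [] u.toList h
  rw [List.nil_append, List.nil_append, wordVal_letter, wordVal_letter] at this
  exact (Con.eq _).1 this

/-- The word over `{1, 2}` representing the image of a letter under `phi i j`. -/
def phiLetter (i j a : Alph) : FreeMonoid (AlphN 2) :=
  if a = i then of a1 else if a = j then of a2 else if i < a ∧ a < j then of a2 * of a1 else 1

/-- The word over `{1, 2}` representing the image of a word under `phi i j`. -/
def phiWord (i j : Alph) (w : FreeMonoid Alph) : FreeMonoid Alph :=
  inclN 2 (FreeMonoid.lift (phiLetter i j) w)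

theorem phi_eq (i j : Alph) (w : FreeMonoid Alph) :
    phi i j w = (hypoConN 2).mk' (FreeMonoid.lift (phiLetter i j) w) := by
  rw [← MonoidHom.comp_apply]
  congr 1
  ext a
  simp only [phi, phiLetter, FreeMonoid.lift_eval_of, MonoidHom.comp_apply]
  split_ifs <;> simp

theorem phi_eq_iff (i j : Alph) (u v : FreeMonoid Alph) :
    phi i j u = phi i j v ↔ SameInv (phiWord i j u).toList (phiWord i j v).toList := by
  rw [phi_eq, phi_eq, ← hypoCon_iff_sameInv]
  exact Con.eq _

theorem toList_phiWord (i j : Alph) (w : FreeMonoid Alph) :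
    (phiWord i j w).toList = w.toList.flatMap fun a =>
      if a = i then [1] else if a = j then [2] else if i < a ∧ a < j then [2, 1] else [] := by
  induction w using FreeMonoid.inductionOn' with
  | one => rfl
  | of_mul a w ih =>
    have : phiWord i j (of a * w) = inclN 2 (phiLetter i j a) * phiWord i j w := by
      simp [phiWord]
    rw [this, FreeMonoid.toList_mul, ih, FreeMonoid.toList_mul, FreeMonoid.toList_of,
      List.singleton_append, List.flatMap_cons]
    congr 1
    simp only [phiLetter]
    split_ifs <;> rfl

theorem mem_phiWord {i j : Alph} {w : FreeMonoid Alph} {k : Alph}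
    (h : k ∈ (phiWord i j w).toList) : k = 1 ∨ k = 2 := by
  rw [toList_phiWord, List.mem_flatMap] at h
  obtain ⟨a, -, ha⟩ := h
  split_ifs at ha <;> simp at ha <;> tauto

theorem one_mem_phiWord {i j : Alph} {w : FreeMonoid Alph} :
    1 ∈ (phiWord i j w).toList ↔ i ∈ w.toList ∨ ∃ k ∈ w.toList, i < k ∧ k < j := by
  rw [toList_phiWord, List.mem_flatMap]
  constructor
  · rintro ⟨a, ha, h⟩
    split_ifs at h <;> simp at h <;> grind
  · rintro (h | ⟨k, hk, h₁, h₂⟩)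
    · exact ⟨i, h, by simp⟩
    · exact ⟨k, hk, by simp [h₁, h₂, h₁.ne', h₂.ne]⟩

theorem sublist_phiWord {i j : Alph} (hij : i < j) (w : FreeMonoid Alph) :
    [2, 1].Sublist (phiWord i j w).toList ↔ Separated i j w.toList := by
  induction w using FreeMonoid.inductionOn' with
  | one => simp [toList_phiWord, Separated]
  | of_mul a w ih =>
    have hone := one_mem_phiWord (i := i) (j := j) (w := w)
    rw [FreeMonoid.toList_mul, FreeMonoid.toList_of, separated_append, ← ih]
    rw [toList_phiWord] at hone ih ⊢
    rw [FreeMonoid.toList_mul, FreeMonoid.toList_of, List.flatMap_append, pair_sublist_append]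
    have h12 : (2 : ℕ+) ≠ 1 := by decide
    have hsep : (∃ k ∈ w.toList, i < k ∧ k < j) → Separated i j w.toList := .inl
    rw [← ih, ← toList_phiWord] at hsep
    rw [← toList_phiWord] at hone ⊢
    simp only [List.flatMap_cons, List.flatMap_nil, List.append_nil, hone]
    split_ifs with h₁ h₂ h₃ <;> simp [Separated, List.sublist_cons_iff] <;> grind

theorem sameInv_phiWord_iff {i j : Alph} (hij : i < j) (u v : FreeMonoid Alph) :
    SameInv (phiWord i j u).toList (phiWord i j v).toList ↔
      (phiWord i j u).toList.Perm (phiWord i j v).toList ∧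
        (Separated i j u.toList ↔ Separated i j v.toList) := by
  have hbet : ∀ w : FreeMonoid Alph,
      Separated 1 2 (phiWord i j w).toList ↔ Separated i j w.toList := by
    intro w
    rw [← sublist_phiWord hij]
    refine or_iff_right ?_
    rintro ⟨k, hk, h₁, h₂⟩
    rcases mem_phiWord hk with rfl | rfl
    · exact lt_irrefl _ h₁
    · exact lt_irrefl _ h₂
  constructor
  · rintro ⟨hp, h⟩
    refine ⟨hp, ?_⟩
    rw [← hbet, ← hbet]
    exact h 1 2 (by decide)
  · rintro ⟨hp, h⟩
    refine ⟨hp, fun k l hkl => ?_⟩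
    rw [← hbet, ← hbet] at h
    by_cases hkl' : k = 1 ∧ l = 2
    · rwa [hkl'.1, hkl'.2]
    · have hno : ∀ w : FreeMonoid Alph, ¬ [l, k].Sublist (phiWord i j w).toList := by
        intro w hw
        have hl := mem_phiWord (hw.subset (List.mem_cons_self ..))
        have hk := mem_phiWord (hw.subset (List.mem_cons_of_mem _ (List.mem_cons_self ..)))
        rcases hk with rfl | rfl <;> rcases hl with rfl | rfl <;> revert hkl hkl' <;> decide
      simp only [Separated, hno, or_false, hp.mem_iff]

theorem phi_eq_of_hypoCon {i j : Alph} (hij : i < j) {u v : FreeMonoid Alph}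
    (h : hypoCon u v) : phi i j u = phi i j v := by
  rw [hypoCon_iff_sameInv] at h
  rw [phi_eq_iff, sameInv_phiWord_iff hij, toList_phiWord, toList_phiWord]
  exact ⟨h.1.flatMap_right _, h.2 i j hij⟩

theorem count_one_phiWord (i : Alph) (w : FreeMonoid Alph) :
    (phiWord i (i + 1) w).toList.count 1 = w.toList.count i := by
  rw [toList_phiWord]
  induction w.toList with
  | nil => rfl
  | cons a w ih =>
    have hbet : ¬ (i < a ∧ a < i + 1) := fun h => (PNat.lt_add_one_iff.1 h.2).not_gt h.1
    rw [List.flatMap_cons, List.count_append, ih, List.count_cons]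
    split_ifs <;> simp_all [add_comm]

theorem hypoCon_of_forall_phi_eq {u v : FreeMonoid Alph}
    (h : ∀ i j : Alph, i < j → phi i j u = phi i j v) : hypoCon u v := by
  have h' := fun i j hij => (sameInv_phiWord_iff hij u v).1 ((phi_eq_iff i j u v).1 (h i j hij))
  rw [hypoCon_iff_sameInv]
  refine ⟨List.perm_iff_count.2 fun i => ?_, fun i j hij => (h' i j hij).2⟩
  rw [← count_one_phiWord i u, ← count_one_phiWord i v]
  exact (h' i (i + 1) (PNat.lt_add_right i 1)).1.count_eq 1

end Hypoplactic

/-- The map `φ` from the infinite-rank hypoplactic monoid `hypo` to the direct product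
of copies of `hypo_2` indexed by all pairs `(i,j)` of positive integers with `i < j`,
whose `(i,j)`-th component sends `[w]` to `φ_{ij}(w)`, is a well-defined injective
monoid homomorphism; the index set is infinite, so `hypo` embeds into a direct product
of infinitely many copies of `hypo_2`. -/
theorem hypo_embeds_prod_hypo2 :
    (∃ f : Hypo →* ({p : Alph × Alph // p.1 < p.2} → HypoN 2),
      (∀ (w : FreeMonoid Alph) (p : {p : Alph × Alph // p.1 < p.2}),
        f (hypoCon.mk' w) p = phi p.1.1 p.1.2 w) ∧
      Function.Injective f) ∧
    Infinite {p : Alph × Alph // p.1 < p.2} := by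
  refine ⟨⟨hypoCon.lift (MonoidHom.pi fun p => phi p.1.1 p.1.2) ?_, fun w p => rfl, ?_⟩, ?_⟩
  · intro u v h
    exact funext fun p => Hypoplactic.phi_eq_of_hypoCon p.2 h
  · intro x y
    induction x, y using Con.induction_on₂ with
    | _ u v =>
      intro h
      exact (Con.eq _).2 <| Hypoplactic.hypoCon_of_forall_phi_eq fun i j hij =>
        congrFun h ⟨(i, j), hij⟩
  · exact Infinite.of_injective (fun n : ℕ+ => ⟨(n, n + 1), PNat.lt_add_right n 1⟩)
      fun m n h => by simpa using congrArg (fun p => p.1.1) h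
end
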